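/- For all i, j ∈ I and all integers u, v with 0 ≤ u ≤ N and −h ≤ v ≤ 0, the double-expansion coefficient c̃_{ij}(u, v) of the inverse (q,t)-deformed Cartan matrix is nonnegative. -/

import Mathlib

noncomputable section

open scoped BigOperators

/-- The field `K = ℚ(q,t)` of rational functions in two variables over `ℚ`. -/
abbrev KK : Type := FractionRing (MvPolynomial (Fin 2) ℚ)

/-- The variable `q` of `ℚ(q,t)`. -/
def qv : KK := algebraMap (MvPolynomial (Fin 2) ℚ) KK (MvPolynomial.X 0)

/-- The variable `t` of `ℚ(q,t)`. -/
def tv : KK := algebraMap (MvPolynomial (Fin 2) ℚ) KK (MvPolynomial.X 1)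

/-- The quantum integer `[k]_q = (q^k - q^{-k})/(q - q⁻¹)` in `ℚ(q,t)`. -/
def qint (k : ℤ) : KK := (qv ^ k - qv ^ (-k)) / (qv - qv⁻¹)

variable {I : Type}

/-- The `(q,t)`-deformed Cartan matrix `C(q,t)`:
`C_{ii} = q^{d_i} t⁻¹ + q^{-d_i} t` and `C_{ij} = [c_{ij}]_q` for `i ≠ j`. -/
def Cqt [DecidableEq I] (c : I → I → ℤ) (d : I → ℤ) (i j : I) : KK :=
  if i = j then qv ^ (d i) * tv⁻¹ + qv ^ (-(d i)) * tv else qint (c i j)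

/-- The basis vector `α_i` of `V = K^{⊕I}`. -/
def alphaK [DecidableEq I] (i : I) : I → KK := Pi.single i 1

/-- The deformed bilinear form `B` on `V`, determined by
`B(α_i, α_j) = [d_i]_q C_{ij}(q,t)`. -/
def Bform [Fintype I] [DecidableEq I] (c : I → I → ℤ) (d : I → ℤ)
    (lam mu : I → KK) : KK :=
  ∑ i, ∑ j, lam i * mu j * (qint (d i) * Cqt c d i j)

/-- The operator `T_i : V → V`, `T_i(λ) = λ - (q^{-d_i} t/[d_i]_q)·B(α_i, λ)·α_i`. -/
def Trefl [Fintype I] [DecidableEq I] (c : I → I → ℤ) (d : I → ℤ) (i : I)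
    (lam : I → KK) : I → KK :=
  fun k => lam k - (qv ^ (-(d i)) * tv / qint (d i)) * Bform c d (alphaK i) lam * alphaK i k

/-- The simple reflection `s_i` on the root lattice `ℤ^{⊕I}`, with `s_i(α_j) = α_j - c_{ij} α_i`. -/
def sZ [Fintype I] [DecidableEq I] (c : I → I → ℤ) (i : I) : (I → ℤ) → (I → ℤ) :=
  fun v k => v k - (if k = i then ∑ j, c i j * v j else 0)

/-- The simple root `α_i` of the root lattice `ℤ^{⊕I}`. -/
def alphaZ [DecidableEq I] (i : I) : I → ℤ := Pi.single i 1

/-- Membership in the Weyl group `W`, the group of automorphisms of the root lattice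
generated by the simple reflections; since each simple reflection is an involution,
`W` is exactly the set of finite products of simple reflections. -/
def memW [Fintype I] [DecidableEq I] (c : I → I → ℤ) (w : (I → ℤ) → (I → ℤ)) : Prop :=
  ∃ l : List I, w = (l.map (sZ c)).foldr (· ∘ ·) id

/-- The field `ℚ((q))` of formal Laurent series. -/
abbrev FF : Type := LaurentSeries ℚ

/-- The field `ℚ((q))((t⁻¹))` of iterated formal Laurent series: the outer variable is
`s = t⁻¹`, so that Laurent expansion in `t⁻¹` (expansion at `t = ∞`) followed by Laurent
expansion at `q = 0` lands in this field. -/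
abbrev LL : Type := LaurentSeries FF

/-- The image of `q` in `ℚ((q))((t⁻¹))`. -/
def qL : LL := HahnSeries.C (HahnSeries.single (1 : ℤ) (1 : ℚ))

/-- The image of `t` in `ℚ((q))((t⁻¹))`: the inverse `s⁻¹` of the outer variable,
i.e. the monomial with outer exponent `-1`. -/
def tL : LL := HahnSeries.single (-1 : ℤ) (1 : FF)

/-- The coefficient of `q^u t^v` of an element of `ℚ((q))((t⁻¹))` (the coefficient of
`t^v`, i.e. of outer exponent `-v`, is a Laurent series in `q`, of which we take the
coefficient of `q^u`). -/
def dcoeff (x : LL) (u v : ℤ) : ℚ := (x.coeff (-v)).coeff u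

/-- One step of the rank two recursion. -/
def rkStep {R : Type} [CommRing R] (a b e f F G : R) (s : Bool) (z : R × R) : R × R :=
  if s then (-a ^ 2 * z.1 + a * e * z.2 + F, z.2) else (z.1, -b ^ 2 * z.2 + b * f * z.1 + G)

/-- The rank two recursion. -/
def rkSeq {R : Type} [CommRing R] (a b e f F G : R) (z : R × R) : ℕ → R × R
  | 0 => z
  | k + 1 => rkStep a b e f F G (k % 2 == 0) (rkSeq a b e f F G z k)

/-- Rank two facts. -/
structure RkTwo {R : Type} [CommRing R] (P : Subsemiring R) (a b e f : R) (m : ℕ) : Prop where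
  pos : ∀ k < m, (rkSeq a b e f 0 0 (0, 1) k).1 ∈ P ∧ (rkSeq a b e f 0 0 (0, 1) k).2 ∈ P
  braid : ∀ F G, rkSeq a b e f F G (0, 0) m = (rkSeq b a f e G F (0, 0) m).swap

theorem rk_zero {R : Type} [CommRing R] (P : Subsemiring R) (a b : R) :
    RkTwo P a b 0 0 2 := by
  constructor
  · intro k hk
    interval_cases k <;> simp [rkSeq, rkStep]
  · intro F G
    simp [rkSeq, rkStep]

theorem rk_one {R : Type} [CommRing R] (P : Subsemiring R) (a : R) (ha : a ∈ P) :
    RkTwo P a a 1 1 3 := by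
  constructor
  · intro k hk
    interval_cases k
    · simp [rkSeq]
    · simpa [rkSeq, rkStep] using ha
    · have : -a ^ 2 + a * a = 0 := by ring
      simpa [rkSeq, rkStep, this] using ha
  · intro F G
    simp [rkSeq, rkStep]
    constructor <;> ring

theorem rk_two {R : Type} [CommRing R] (P : Subsemiring R) (q q' : R) (hq : q * q' = 1)
    (h1 : q ∈ P) :
    RkTwo P q (q ^ 2) (q + q') 1 4 := by
  have e : q * (q + q') = q ^ 2 + 1 := by linear_combination hq
  constructor
  · intro k hk
    have hq2 : q ^ 2 ∈ P := pow_mem h1 2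
    have hq3 : q ^ 2 + 1 ∈ P := add_mem hq2 (one_mem P)
    have e2 : -(q ^ 2) ^ 2 + q ^ 2 * (q ^ 2 + 1) = q ^ 2 := by ring
    have e3 : -q ^ 2 * (q ^ 2 + 1) + (q ^ 2 + 1) * q ^ 2 = 0 := by ring
    interval_cases k
    · simp [rkSeq]
    · simpa [rkSeq, rkStep, e] using hq3
    · simp only [rkSeq, rkStep, e]
      norm_num
      exact ⟨hq3, by simpa only [e2] using hq2⟩
    · simp only [rkSeq, rkStep, e]
      norm_num
      simp only [e2]
      exact ⟨by convert P.zero_mem using 1; ring, hq2⟩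
  · intro F G
    simp only [rkSeq, rkStep, e]
    norm_num
    constructor <;> ring

theorem rk_two' {R : Type} [CommRing R] (P : Subsemiring R) (q q' : R) (hq : q * q' = 1)
    (h1 : q ∈ P) :
    RkTwo P (q ^ 2) q 1 (q + q') 4 := by
  have e : q * (q + q') = q ^ 2 + 1 := by linear_combination hq
  constructor
  · intro k hk
    have hq2 : q ^ 2 ∈ P := pow_mem h1 2
    interval_cases k
    · simp [rkSeq]
    · simpa [rkSeq, rkStep, e] using hq2
    · simp only [rkSeq, rkStep, e]
      norm_num
      exact ⟨hq2, by convert pow_mem h1 4 using 1; ring⟩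
    · simp only [rkSeq, rkStep, e]
      norm_num
      exact ⟨by convert P.zero_mem using 1; ring, by convert pow_mem h1 4 using 1; ring⟩
  · intro F G
    simp only [rkSeq, rkStep, e]
    norm_num
    constructor <;> ring

theorem rk_three {R : Type} [CommRing R] (P : Subsemiring R) (q q' : R) (hq : q * q' = 1)
    (h1 : q ∈ P) (h2 : q' ∈ P) :
    RkTwo P q (q ^ 3) (q ^ 2 + 1 + q' ^ 2) 1 6 := by
  have e : q * (q ^ 2 + 1 + q' ^ 2) = q ^ 3 + q + q' := by linear_combination q' * hq
  have m1 : q ^ 3 + q + q' ∈ P := add_mem (add_mem (pow_mem h1 3) h1) h2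
  have m2 : q ^ 4 + q ^ 2 ∈ P := add_mem (pow_mem h1 4) (pow_mem h1 2)
  have m3 : q ^ 7 + q ^ 5 + q ^ 3 ∈ P :=
    add_mem (add_mem (pow_mem h1 7) (pow_mem h1 5)) (pow_mem h1 3)
  have m4 : q ^ 6 ∈ P := pow_mem h1 6
  constructor
  · intro k hk
    interval_cases k <;> simp only [rkSeq, rkStep, e] <;> norm_num
    · exact m1
    · exact ⟨m1, by convert m2 using 1; grind⟩
    · exact ⟨by convert m3 using 1; grind, by convert m2 using 1; grind⟩
    · exact ⟨by convert m3 using 1; grind, by convert m4 using 1; grind⟩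
    · exact ⟨by convert P.zero_mem using 1; grind, by convert m4 using 1; grind⟩
  · intro F G
    simp only [rkSeq, rkStep, e]
    norm_num
    constructor <;> grind

theorem rk_three' {R : Type} [CommRing R] (P : Subsemiring R) (q q' : R) (hq : q * q' = 1)
    (h1 : q ∈ P) :
    RkTwo P (q ^ 3) q 1 (q ^ 2 + 1 + q' ^ 2) 6 := by
  have e : q * (q ^ 2 + 1 + q' ^ 2) = q ^ 3 + q + q' := by linear_combination q' * hq
  have m1 : q ^ 3 ∈ P := pow_mem h1 3
  have m2 : q ^ 6 + q ^ 4 ∈ P := add_mem (pow_mem h1 6) (pow_mem h1 4)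
  have m3 : q ^ 7 ∈ P := pow_mem h1 7
  have m4 : q ^ 10 ∈ P := pow_mem h1 10
  constructor
  · intro k hk
    interval_cases k <;> simp only [rkSeq, rkStep, e] <;> norm_num
    · exact m1
    · exact ⟨m1, by convert m2 using 1; grind⟩
    · exact ⟨by convert m3 using 1; grind, by convert m2 using 1; grind⟩
    · exact ⟨by convert m3 using 1; grind, by convert m4 using 1; grind⟩
    · exact ⟨by convert P.zero_mem using 1; grind, by convert m4 using 1; grind⟩
  · intro F G
    simp only [rkSeq, rkStep, e]
    norm_num
    constructor <;> grind

/-- The functional giving the increment of the deformed reflection. -/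
def gfun {R : Type} [CommRing R] [Fintype I] (p : I → R) (A : I → I → R) (i : I) :
    (I → R) →ₗ[R] R :=
  (-(1 + p i ^ 2)) • LinearMap.proj i + p i • ∑ k, A i k • LinearMap.proj k

/-- The deformed reflection. -/
def Tg {R : Type} [CommRing R] [Fintype I] [DecidableEq I] (p : I → R) (A : I → I → R) (i : I) :
    Module.End R (I → R) :=
  1 + (LinearMap.toSpanSingleton R (I → R) (Pi.single i 1)) ∘ₗ gfun p A i

/-- The action of a word. -/
def act {R : Type} [CommRing R] [Fintype I] [DecidableEq I] (p : I → R) (A : I → I → R)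
    (L : List I) : Module.End R (I → R) := (L.map (Tg p A)).prod

section basic
variable {R : Type} [CommRing R] [Fintype I] (p : I → R) (A : I → I → R)

theorem gfun_apply (i : I) (l : I → R) :
    gfun p A i l = -(1 + p i ^ 2) * l i + p i * ∑ k, A i k * l k := by
  simp [gfun]

variable [DecidableEq I]

theorem Tg_apply (i : I) (l : I → R) :
    Tg p A i l = l + gfun p A i l • Pi.single i 1 := by
  simp [Tg]

theorem Tg_apply' (i : I) (l : I → R) (k : I) :
    Tg p A i l k = if k = i then -p i ^ 2 * l i + p i * ∑ j, A i j * l j else l k := by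
  rw [Tg_apply, gfun_apply]
  by_cases h : k = i
  · subst h
    simp
    ring
  · simp [h]

theorem act_append (L L' : List I) : act p A (L ++ L') = act p A L * act p A L' := by
  simp [act]

theorem act_cons (i : I) (L : List I) : act p A (i :: L) = Tg p A i * act p A L := by
  simp [act]

@[simp] theorem act_nil : act p A [] = 1 := by
  simp [act]

theorem gfun_self (hA : ∀ i, A i i = 0) (i : I) :
    gfun p A i (Pi.single i 1) = -(1 + p i ^ 2) := by
  rw [gfun_apply]
  simp [Pi.single_apply, hA]

theorem gfun_other (i j : I) (h : i ≠ j) :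
    gfun p A i (Pi.single j 1) = p i * A i j := by
  rw [gfun_apply]
  simp [Pi.single_apply, h]

end basic

/-- Alternating letters. -/
def ltr (i j : I) (k : ℕ) : I := if k % 2 == 0 then i else j

/-- Alternating words (of length `k`, ending in `i`). -/
def wd (i j : I) : ℕ → List I
  | 0 => []
  | k + 1 => ltr i j k :: wd i j k

theorem wd_length (i j : I) (k : ℕ) : (wd i j k).length = k := by
  induction k with
  | zero => rfl
  | succ k ih => simp [wd, ih]

theorem ltr_ltr (i j : I) (n k : ℕ) :
    ltr (ltr i j n) (ltr i j (n + 1)) k = ltr i j (n + k) := by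
  unfold ltr
  rcases Nat.mod_two_eq_zero_or_one n with h | h <;>
  rcases Nat.mod_two_eq_zero_or_one k with h' | h' <;>
  simp [Nat.add_mod, h, h']

theorem wd_split (i j : I) (n m : ℕ) :
    wd i j (n + m) = wd (ltr i j n) (ltr i j (n + 1)) m ++ wd i j n := by
  induction m with
  | zero => simp [wd]
  | succ m ih =>
    rw [← add_assoc, wd, wd, ih, ltr_ltr]
    rfl

theorem wd_succ' (i j : I) (k : ℕ) : wd i j (k + 1) = wd j i k ++ [i] := by
  rw [add_comm, wd_split]
  rfl

section two
variable {R : Type} [CommRing R] [Fintype I] [DecidableEq I] (p : I → R) (A : I → I → R)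

theorem act_wd (hA : ∀ i, A i i = 0) (i j : I) (hij : i ≠ j) (l : I → R) (z : R × R) (k : ℕ) :
    act p A (wd i j k) (l + z.1 • Pi.single i 1 + z.2 • Pi.single j 1) =
      l + (rkSeq (p i) (p j) (A i j) (A j i) (gfun p A i l) (gfun p A j l) z k).1 • Pi.single i 1
        + (rkSeq (p i) (p j) (A i j) (A j i) (gfun p A i l) (gfun p A j l) z k).2
          • Pi.single j 1 := by
  induction k with
  | zero => simp [wd, rkSeq]
  | succ k ih =>
    rw [wd, act_cons, Module.End.mul_apply, ih, Tg_apply, rkSeq, rkStep, ltr]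
    generalize rkSeq (p i) (p j) (A i j) (A j i) (gfun p A i l) (gfun p A j l) z k = w
    by_cases h : (k % 2 == 0) = true
    · simp only [h, if_true, map_add, map_smul, gfun_self p A hA, gfun_other p A i j hij,
        smul_eq_mul]
      module
    · simp only [h, Bool.false_eq_true, if_false]
      simp only [map_add, map_smul, gfun_self p A hA, gfun_other p A j i hij.symm,
        smul_eq_mul]
      module

theorem act_wd_single (hA : ∀ i, A i i = 0) (i j : I) (hij : i ≠ j) (k : ℕ) :
    act p A (wd i j k) (Pi.single j 1) =
      (rkSeq (p i) (p j) (A i j) (A j i) 0 0 (0, 1) k).1 • Pi.single i 1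
        + (rkSeq (p i) (p j) (A i j) (A j i) 0 0 (0, 1) k).2 • Pi.single j 1 := by
  have := act_wd p A hA i j hij 0 (0, 1) k
  simpa using this

theorem act_wd_braid (hA : ∀ i, A i i = 0) (i j : I) (hij : i ≠ j) (m : ℕ) (P : Subsemiring R)
    (h : RkTwo P (p i) (p j) (A i j) (A j i) m) :
    act p A (wd i j m) = act p A (wd j i m) := by
  ext1 l
  apply LinearMap.ext
  intro x
  have h1 := act_wd p A hA i j hij (Pi.single l x) (0, 0) m
  have h2 := act_wd p A hA j i hij.symm (Pi.single l x) (0, 0) m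
  simp only [zero_smul, add_zero] at h1 h2
  simp only [LinearMap.comp_apply, LinearMap.single_apply]
  rw [h1, h2, h.braid]
  simp only [Prod.fst_swap, Prod.snd_swap]
  abel

end two

section refl
variable [Fintype I] [DecidableEq I] (A : I → I → ℤ)

/-- Undeformed word action. -/
def sact (L : List I) : Module.End ℤ (I → ℤ) := act (fun _ => 1) A L

theorem s_sq (hA : ∀ i, A i i = 0) (i : I) : Tg (fun _ => 1) A i * Tg (fun _ => 1) A i = 1 := by
  apply LinearMap.ext
  intro l
  rw [Module.End.mul_apply, Tg_apply, Tg_apply, map_add, map_smul, gfun_self _ _ hA]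
  simp only [smul_eq_mul, Module.End.one_apply]
  module

theorem sact_rev (hA : ∀ i, A i i = 0) (L : List I) : sact A L.reverse * sact A L = 1 := by
  induction L with
  | nil => simp [sact]
  | cons x L ih =>
    rw [List.reverse_cons, sact, sact, act_append, act_cons, act_cons]
    simp only [act_nil, mul_one]
    rw [mul_assoc, ← mul_assoc (Tg _ A x), s_sq A hA, one_mul]
    exact ih

theorem sact_inj (hA : ∀ i, A i i = 0) (L : List I) (v : I → ℤ) (h : sact A L v = 0) : v = 0 := by
  have := congrArg (fun f : Module.End ℤ (I → ℤ) => f v) (sact_rev A hA L)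
  simpa [Module.End.mul_apply, h] using this.symm

theorem sact_single_ne (hA : ∀ i, A i i = 0) (L : List I) (j : I) :
    sact A L (Pi.single j 1) ≠ 0 := by
  intro h
  have := congrFun (sact_inj A hA L _ h) j
  simp at this

theorem sact_append (L L' : List I) : sact A (L ++ L') = sact A L * sact A L' :=
  act_append _ _ _ _

theorem sact_single (i : I) : sact A [i] = Tg (fun _ => 1) A i := by
  simp [sact, act_cons]

/-- Good words: all the prefix roots are nonnegative. -/
def Gd (w : Module.End ℤ (I → ℤ)) : List I → Prop
  | [] => True
  | x :: l => 0 ≤ w (Pi.single x 1) ∧ Gd (w * Tg (fun _ => 1) A x) l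

theorem Gd_append (w : Module.End ℤ (I → ℤ)) (l l' : List I) :
    Gd A w (l ++ l') ↔ Gd A w l ∧ Gd A (w * sact A l) l' := by
  induction l generalizing w with
  | nil => simp [Gd, sact]
  | cons x l ih =>
    rw [List.cons_append, Gd, Gd, ih, sact, sact, act_cons, mul_assoc, and_assoc]

/-- the result of the key theorem -/
def Res {R : Type} [CommRing R] (p : I → R) (B : I → I → R) (P : Subsemiring R)
    (L : List I) (j : I) : Prop :=
  (0 ≤ sact A L (Pi.single j 1) ∧ ∀ k, act p B L (Pi.single j 1) k ∈ P) ∨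
  (sact A L (Pi.single j 1) ≤ 0 ∧ ∃ L' : List I, L'.length + 1 = L.length ∧
    Gd A 1 (L' ++ [j]) ∧ sact A (L' ++ [j]) = sact A L ∧ act p B (L' ++ [j]) = act p B L)

theorem inner_lemma {R : Type} [CommRing R] (p : I → R) (B : I → I → R) (P : Subsemiring R)
    (n : ℕ) (IH : ∀ L : List I, L.length < n → Gd A 1 L → ∀ j, Res A p B P L j) (i j : I) :
    ∀ (N : ℕ) (v : List I) (k : ℕ), v.length = N → 1 ≤ k → v.length + k = n →
      Gd A 1 (v ++ wd i j k) →
      ∃ (v' : List I) (k' : ℕ), 1 ≤ k' ∧ v'.length + k' = n ∧ Gd A 1 (v' ++ wd i j k') ∧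
        sact A (v' ++ wd i j k') = sact A (v ++ wd i j k) ∧
        act p B (v' ++ wd i j k') = act p B (v ++ wd i j k) ∧
        0 ≤ sact A v' (Pi.single (ltr i j k') 1) ∧
        ∀ x, act p B v' (Pi.single (ltr i j k') 1) x ∈ P := by
  intro N
  induction N with
  | zero =>
    intro v k hv hk hn hg
    rcases IH v (by omega) ((Gd_append A _ _ _).1 hg).1 (ltr i j k) with h | ⟨_, L', hL', _⟩
    · exact ⟨v, k, hk, hn, hg, rfl, rfl, h.1, h.2⟩
    · omega
  | succ N ih =>
    intro v k hv hk hn hg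
    have hg' := (Gd_append A _ _ _).1 hg
    rcases IH v (by omega) hg'.1 (ltr i j k) with h | ⟨_, L', hL', hgL, hs, hT⟩
    · exact ⟨v, k, hk, hn, hg, rfl, rfl, h.1, h.2⟩
    · have e : L' ++ wd i j (k + 1) = (L' ++ [ltr i j k]) ++ wd i j k := by simp [wd]
      obtain ⟨v', k', h1, h2, h3, h4, h5, h6⟩ := ih L' (k + 1) (by omega) (by omega) (by omega)
        (by rw [e, Gd_append, hs]; exact ⟨hgL, hg'.2⟩)
      refine ⟨v', k', h1, h2, h3, ?_, ?_, h6⟩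
      · rw [h4, e, sact_append, hs, ← sact_append]
      · rw [h5, e, act_append, hT, ← act_append]

/-- The rank two hypotheses for an ordered pair of indices. -/
structure RkPair {R : Type} [CommRing R] (p : I → R) (B : I → I → R) (P : Subsemiring R)
    (i j : I) (m : ℕ) : Prop where
  rZ : RkTwo (Subsemiring.nonneg ℤ) 1 1 (A i j) (A j i) m
  top : rkSeq 1 1 (A i j) (A j i) 0 0 (0, 1) m = (0, -1) ∨
       rkSeq 1 1 (A i j) (A j i) 0 0 (0, 1) m = (-1, 0)
  rR : RkTwo P (p i) (p j) (B i j) (B j i) m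

theorem Gd_wd (hA : ∀ i, A i i = 0) (w : Module.End ℤ (I → ℤ)) (m : ℕ) (k : ℕ) (hk : k ≤ m) :
    ∀ i j : I, i ≠ j →
    RkTwo (Subsemiring.nonneg ℤ) 1 1 (A i j) (A j i) m →
    RkTwo (Subsemiring.nonneg ℤ) 1 1 (A j i) (A i j) m →
    0 ≤ w (Pi.single i 1) → 0 ≤ w (Pi.single j 1) → Gd A w (wd i j k) := by
  induction k with
  | zero => intros; trivial
  | succ k ih =>
    intro i j hij h1 h2 hi hj
    rw [wd_succ', Gd_append]
    refine ⟨ih (by omega) j i hij.symm h2 h1 hj hi, ?_, trivial⟩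
    have z := h2.pos k (by omega)
    rw [Module.End.mul_apply]
    unfold sact
    rw [act_wd_single _ _ hA j i hij.symm]
    simp only [map_add, map_smul]
    exact add_nonneg (smul_nonneg z.1 hj) (smul_nonneg z.2 hi)

theorem key_thm (hA : ∀ i, A i i = 0)
    {R : Type} [CommRing R] (p : I → R) (B : I → I → R) (hB : ∀ i, B i i = 0) (P : Subsemiring R)
    (hrk : ∀ i j, i ≠ j → ∃ m, RkPair A p B P i j m ∧ RkPair A p B P j i m) :
    ∀ (n : ℕ) (L : List I), L.length = n → Gd A 1 L → ∀ j, Res A p B P L j := by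
  intro n
  induction n using Nat.strong_induction_on with
  | _ n IH0 =>
  intro L hL hg j
  have IH : ∀ L : List I, L.length < n → Gd A 1 L → ∀ j, Res A p B P L j :=
    fun L h => IH0 _ h L rfl
  rcases List.eq_nil_or_concat L with rfl | ⟨L0, i, rfl⟩
  · left
    simp only [sact, act_nil, Module.End.one_apply]
    refine ⟨by simp, fun k => ?_⟩
    by_cases h : k = j
    · subst h; simp
    · simp [h]
  rw [List.concat_eq_append] at *
  have hg0 := (Gd_append A _ _ _).1 hg
  by_cases hij : i = j
  · subst hij
    right
    refine ⟨?_, L0, by simp, hg, rfl, rfl⟩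
    rw [sact_append, sact_single, Module.End.mul_apply, Tg_apply, gfun_self _ _ hA]
    have h0 : 0 ≤ sact A L0 (Pi.single i 1) := by simpa [Gd] using hg0.2
    have e : (Pi.single i 1 : I → ℤ) + (-(1 + (1 : ℤ) ^ 2)) • Pi.single i 1 = - Pi.single i 1 := by
      module
    rw [e, map_neg]
    simpa using h0
  have e1 : wd i j 1 = [i] := rfl
  obtain ⟨v, k, hk, hvn, hgv, hs, hT, hp1, hp2⟩ := inner_lemma A p B P n IH i j L0.length L0 1 rfl
    le_rfl (by simpa using hL) (by rw [e1]; exact hg)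
  rw [e1] at hs hT
  rw [Res, ← hs, ← hT, hL]
  have hgv' := (Gd_append A _ _ _).1 hgv
  obtain ⟨k, rfl⟩ : ∃ k0, k = k0 + 1 := ⟨k - 1, by omega⟩
  -- first letter
  have hf1 : 0 ≤ sact A v (Pi.single (ltr i j k) 1) := by
    have := hgv'.2
    rw [wd, Gd, one_mul] at this
    exact this.1
  have hf2 : ∀ x, act p B v (Pi.single (ltr i j k) 1) x ∈ P := by
    rcases IH v (by omega) hgv'.1 (ltr i j k) with h | h
    · exact h.2
    · exact absurd (le_antisymm h.1 hf1) (sact_single_ne A hA _ _)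
  have hall : ∀ y, y = i ∨ y = j → 0 ≤ sact A v (Pi.single y 1) ∧
      ∀ x, act p B v (Pi.single y 1) x ∈ P := by
    intro y hy
    have : y = ltr i j k ∨ y = ltr i j (k + 1) := by
      unfold ltr
      rcases Nat.mod_two_eq_zero_or_one k with h | h <;> simp [Nat.add_mod, h] <;> tauto
    rcases this with rfl | rfl
    · exact ⟨hf1, hf2⟩
    · exact ⟨hp1, hp2⟩
  obtain ⟨hi1, hi2⟩ := hall i (Or.inl rfl)
  obtain ⟨hj1, hj2⟩ := hall j (Or.inr rfl)
  obtain ⟨m, ⟨hmZ, htop, hmR⟩, hji⟩ := hrk i j hij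
  rcases lt_trichotomy (k + 1) m with hkm | hkm | hkm
  · left
    have e := act_wd_single (fun _ => 1) A hA i j hij (k + 1)
    rw [sact_append, act_append, Module.End.mul_apply, Module.End.mul_apply,
      act_wd_single _ _ hB i j hij, sact, sact, e]
    have z := hmZ.pos _ hkm
    have zR := hmR.pos _ hkm
    simp only [map_add, map_smul]
    refine ⟨add_nonneg (smul_nonneg z.1 hi1) (smul_nonneg z.2 hj1), fun x => ?_⟩
    simp only [Pi.add_apply, Pi.smul_apply, smul_eq_mul]
    exact add_mem (mul_mem zR.1 (hi2 x)) (mul_mem zR.2 (hj2 x))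
  · right
    have br : sact A (wd i j m) = sact A (wd j i m) := act_wd_braid _ _ hA i j hij m _ hmZ
    have brR : act p B (wd i j m) = act p B (wd j i m) := act_wd_braid _ _ hB i j hij m _ hmR
    have ew := wd_succ' j i k
    rw [hkm]
    have et : v ++ wd i j k ++ [j] = v ++ wd j i m := by
      rw [← hkm, ew, List.append_assoc]
    refine ⟨?_, v ++ wd i j k, by simp [wd_length]; omega, ?_, ?_, ?_⟩
    · rw [sact_append, Module.End.mul_apply, sact, sact, act_wd_single _ _ hA i j hij]
      rcases htop with h | h <;> rw [h] <;> simpa using by assumption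
    · rw [et, Gd_append, one_mul]
      exact ⟨hgv'.1, Gd_wd A hA _ m m le_rfl j i (Ne.symm hij) hji.rZ hmZ hj1 hi1⟩
    · rw [et, sact_append, sact_append, br]
    · rw [et, act_append, act_append, brR]
  · exfalso
    obtain ⟨n', hn'⟩ : ∃ n', k + 1 = (n' + 1) + m := ⟨k - m, by omega⟩
    have h2 := hgv'.2
    rw [one_mul, hn', wd_split, Gd_append] at h2
    have h3 := h2.2
    rw [wd, Gd] at h3
    have h4 := h3.1
    have e5 : ltr i j (n' + 1 + 1) = ltr i j n' := by
      simp [ltr, add_assoc]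
    have hne : ltr i j (n' + 1) ≠ ltr i j n' := by
      unfold ltr
      rcases Nat.mod_two_eq_zero_or_one n' with h | h <;> simp [Nat.add_mod, h] <;> tauto
    have e6 : ∀ x, ltr i j x = i ∨ ltr i j x = j := by
      intro x; unfold ltr; split <;> simp
    have e7 : RkPair A p B P (ltr i j (n' + 1)) (ltr i j n') m := by
      rcases e6 n' with h | h <;> rcases e6 (n' + 1) with h' | h' <;> rw [h, h']
      · exact absurd (h'.trans h.symm) hne
      · exact hji
      · exact ⟨hmZ, htop, hmR⟩
      · exact absurd (h'.trans h.symm) hne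
    rw [e5, Module.End.mul_apply] at h4
    have e8 := act_wd_single (fun _ => 1) A hA _ _ hne m
    rw [sact, sact, e8] at h4
    have hx := (hall _ (e6 n')).1
    have hy := (hall _ (e6 (n' + 1))).1
    rcases e7.top with h | h <;> rw [h] at h4 <;> simp only [zero_smul, zero_add, add_zero,
      neg_smul, one_smul, map_neg, Left.nonneg_neg_iff] at h4
    · exact sact_single_ne A hA _ _ (le_antisymm h4 hx)
    · exact sact_single_ne A hA _ _ (le_antisymm h4 hy)

/-- Every word acts like a good word. -/
theorem exists_good (hA : ∀ i, A i i = 0)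
    {R : Type} [CommRing R] (p : I → R) (B : I → I → R) (hB : ∀ i, B i i = 0) (P : Subsemiring R)
    (hrk : ∀ i j, i ≠ j → ∃ m, RkPair A p B P i j m ∧ RkPair A p B P j i m) (L : List I) :
    ∃ L', Gd A 1 L' ∧ sact A L' = sact A L := by
  induction L using List.reverseRecOn with
  | nil => exact ⟨[], trivial, rfl⟩
  | append_singleton L x ih =>
    obtain ⟨L', hg, hs⟩ := ih
    rcases key_thm A hA p B hB P hrk _ L' rfl hg x with h | ⟨_, L2, _, hg2, hs2, _⟩
    · refine ⟨L' ++ [x], ?_, ?_⟩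
      · rw [Gd_append, one_mul]
        exact ⟨hg, h.1, trivial⟩
      · rw [sact_append, sact_append, hs]
    · refine ⟨L2, ((Gd_append _ _ _ _).1 hg2).1, ?_⟩
      rw [sact_append, ← hs, ← hs2, sact_append, mul_assoc, sact_single, s_sq A hA, mul_one]

theorem root_sign (hA : ∀ i, A i i = 0)
    {R : Type} [CommRing R] (p : I → R) (B : I → I → R) (hB : ∀ i, B i i = 0) (P : Subsemiring R)
    (hrk : ∀ i j, i ≠ j → ∃ m, RkPair A p B P i j m ∧ RkPair A p B P j i m) (L : List I) (j : I) :
    0 ≤ sact A L (Pi.single j 1) ∨ sact A L (Pi.single j 1) ≤ 0 := by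
  obtain ⟨L', hg, hs⟩ := exists_good A hA p B hB P hrk L
  rw [← hs]
  rcases key_thm A hA p B hB P hrk _ L' rfl hg j with h | h
  · exact Or.inl h.1
  · exact Or.inr h.1

end refl

/-- A colour class as a list. -/
def cls [Fintype I] (ε : I → Bool) (b : Bool) : List I :=
  (Finset.univ.filter (fun i => ε i = b)).toList

/-- Alternating products of colour classes. -/
def Bw [Fintype I] (ε : I → Bool) : ℕ → Bool → List I
  | 0, _ => []
  | n + 1, b => cls ε b ++ Bw ε n (!b)

/-- The basic recursion. -/
def xs {R : Type} [CommRing R] [Fintype I] [DecidableEq I] (p : I → R) (A : I → I → R) (j : I) :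
    ℕ → I → R
  | 0 => 0
  | 1 => Pi.single j 1
  | n + 2 => fun i => -p i ^ 2 * xs p A j n i + p i * ∑ k, A i k * xs p A j (n + 1) k

theorem Bw_succ [Fintype I] (ε : I → Bool) (n : ℕ) (b : Bool) :
    Bw ε (n + 1) b = Bw ε n b ++ cls ε (not^[n] b) := by
  induction n generalizing b with
  | zero => simp [Bw]
  | succ n ih =>
    rw [Bw, ih, Bw, List.append_assoc, Function.iterate_succ_apply]

section bip
variable {R : Type} [CommRing R] [Fintype I] [DecidableEq I] (p : I → R) (A : I → I → R)
  (ε : I → Bool)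

theorem act_class (hε : ∀ i k, ε i = ε k → A i k = 0)
    (b : Bool) (l : List I) (hl : l.Nodup) (hb : ∀ i ∈ l, ε i = b) (v : I → R)
    (k : I) : act p A l v k = if k ∈ l then -p k ^ 2 * v k + p k * ∑ j, A k j * v j else v k := by
  induction l generalizing k with
  | nil => simp
  | cons x l ih =>
    have hl' := List.nodup_cons.1 hl
    have ih' := ih hl'.2 (fun i hi => hb i (List.mem_cons_of_mem _ hi))
    rw [act_cons, Module.End.mul_apply, Tg_apply']
    by_cases h : k = x
    · subst h
      simp only [if_true, List.mem_cons_self]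
      rw [ih' k, if_neg hl'.1]
      congr 2
      apply Finset.sum_congr rfl
      intro j _
      rw [ih' j]
      split_ifs with hj
      · rw [hε k j]
        · simp
        · rw [hb k (by simp), hb j (by simp [hj])]
      · rfl
    · simp only [h, if_false, List.mem_cons, false_or]
      exact ih' k

theorem act_cls (hε : ∀ i k, ε i = ε k → A i k = 0)
    (b : Bool) (v : I → R) (k : I) : act p A (cls ε b) v k =
    if ε k = b then -p k ^ 2 * v k + p k * ∑ j, A k j * v j else v k := by
  rw [act_class p A ε hε b (cls ε b) (Finset.nodup_toList _) (by simp [cls])]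
  simp [cls]

theorem xs_supp (hε : ∀ i k, ε i = ε k → A i k = 0)
    (j : I) (n : ℕ) (k : I) (hk : ε k = not^[n] (ε j)) : xs p A j n k = 0 := by
  induction n using Nat.strong_induction_on generalizing k with
  | _ n ih =>
  match n with
  | 0 => rfl
  | 1 =>
    simp only [xs]
    have : k ≠ j := by
      rintro rfl
      simp at hk
    simp [this]
  | n + 2 =>
    have h2 : not^[n + 2] (ε j) = not^[n] (ε j) := by
      simp [Function.iterate_succ_apply]
    rw [h2] at hk
    simp only [xs]
    rw [ih n (by omega) k hk, Finset.sum_eq_zero]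
    · simp
    intro i _
    by_cases h : ε k = ε i
    · rw [hε _ _ h, zero_mul]
    · rw [ih (n + 1) (by omega) i, mul_zero]
      rw [Function.iterate_succ_apply', ← hk]
      cases hx : ε k <;> cases hy : ε i <;> simp_all

theorem act_Bw (hε : ∀ i k, ε i = ε k → A i k = 0)
    (j : I) (n : ℕ) : act p A (Bw ε n (not^[n] (ε j))) (Pi.single j 1) =
    xs p A j (n + 1) + xs p A j n := by
  induction n with
  | zero => simp [Bw, xs]
  | succ n ih =>
    have e : (!(not^[n + 1] (ε j))) = not^[n] (ε j) := by
      rw [Function.iterate_succ_apply']; simp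
    rw [Bw, act_append, Module.End.mul_apply, e, ih]
    ext k
    rw [act_cls p A ε hε]
    split_ifs with h
    · simp only [Pi.add_apply]
      rw [xs_supp p A ε hε j (n + 1) k h]
      simp only [xs]
      simp only [mul_add, Finset.sum_add_distrib, zero_add, add_zero]
      have : ∑ i, A k i * xs p A j n i = 0 := by
        apply Finset.sum_eq_zero
        intro i _
        by_cases h' : ε k = ε i
        · rw [hε _ _ h', zero_mul]
        · rw [xs_supp p A ε hε j n i, mul_zero]
          rw [h] at h'
          rw [← e]
          cases hx : not^[n + 1] (ε j) <;> cases hy : ε i <;> simp_all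
      rw [this]
      simp
    · have h' : ε k = not^[n] (ε j) := by
        rw [← e]
        cases hx : not^[n + 1] (ε j) <;> cases hy : ε k <;> simp_all
      have h'' : ε k = not^[n + 2] (ε j) := by
        simpa [Function.iterate_succ_apply] using h'
      simp only [Pi.add_apply]
      rw [xs_supp p A ε hε j n k h', xs_supp p A ε hε j (n + 2) k h'']
      ring

theorem xs_split (hε : ∀ i k, ε i = ε k → A i k = 0)
    (j : I) (n : ℕ) (k : I) : xs p A j (n + 1) k = 0 ∨ xs p A j n k = 0 := by
  by_cases h : ε k = not^[n] (ε j)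
  · exact Or.inr (xs_supp p A ε hε j n k h)
  · left
    apply xs_supp p A ε hε j (n + 1) k
    rw [Function.iterate_succ_apply']
    cases hx : not^[n] (ε j) <;> cases hy : ε k <;> simp_all

end bip

theorem Gd_class [Fintype I] [DecidableEq I] (A : I → I → ℤ) (ε : I → Bool)
    (hε : ∀ i k, ε i = ε k → A i k = 0) (b : Bool) (l : List I) (hl : l.Nodup)
    (hb : ∀ i ∈ l, ε i = b) (w : Module.End ℤ (I → ℤ)) (hw : ∀ i ∈ l, 0 ≤ w (Pi.single i 1)) :
    Gd A w l := by
  induction l generalizing w with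
  | nil => trivial
  | cons x l ih =>
    have hl' := List.nodup_cons.1 hl
    refine ⟨hw x (by simp), ih hl'.2 (fun i hi => hb i (by simp [hi])) _ ?_⟩
    intro i hi
    have hxi : x ≠ i := by rintro rfl; exact hl'.1 hi
    rw [Module.End.mul_apply, Tg_apply, gfun_other _ _ _ _ hxi, hε x i]
    · simpa using hw i (by simp [hi])
    · rw [hb x (by simp), hb i (by simp [hi])]

theorem not_iter_iter (n : ℕ) (b : Bool) : not^[n] (not^[n] b) = b := by
  rw [← Function.iterate_add_apply, ← two_mul, Function.iterate_mul]
  have : not^[2] = id := by ext b; cases b <;> rfl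
  simp [this]

theorem Gd_Bw [Fintype I] [DecidableEq I] (A : I → I → ℤ) (ε : I → Bool)
    (hε : ∀ i k, ε i = ε k → A i k = 0) (n : ℕ)
    (h : ∀ k < n, ∀ j, 0 ≤ xs (fun _ => 1) A j (k + 1) + xs (fun _ => 1) A j k) (b : Bool) :
    Gd A 1 (Bw ε n b) := by
  induction n with
  | zero => trivial
  | succ n ih =>
    rw [Bw_succ, Gd_append, one_mul]
    refine ⟨ih (fun k hk => h k (by omega)), ?_⟩
    apply Gd_class A ε hε (not^[n] b) _ (Finset.nodup_toList _) (by simp)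
    intro i hi
    have hi' : ε i = not^[n] b := by simpa [cls] using hi
    have e : b = not^[n] (ε i) := by rw [hi', not_iter_iter]
    rw [sact, e, act_Bw _ A ε hε]
    exact h n (by omega) i

/-- Chebyshev-like polynomials. -/
def Up : ℕ → Polynomial ℤ
  | 0 => 0
  | 1 => 1
  | n + 2 => Polynomial.X * Up (n + 1) - Up n

theorem Up_cassini (n : ℕ) :
    Up (n + 1) ^ 2 + Up n ^ 2 - Polynomial.X * Up (n + 1) * Up n = 1 := by
  induction n with
  | zero => simp [Up]
  | succ n ih =>
    rw [Up]
    linear_combination ih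

theorem Up_sum_sq (m : ℕ) :
    ∑ n ∈ Finset.range m, (Up (n + 1) + Up n) ^ 2 * (2 - Polynomial.X) =
      2 * (m : Polynomial ℤ) + Up m * (Polynomial.X * Up m - 2 * Up (m + 1)) := by
  induction m with
  | zero => simp [Up]
  | succ m ih =>
    rw [Finset.sum_range_succ, ih]
    push_cast
    have h := Up_cassini m
    have e : Up (m + 1 + 1) = Polynomial.X * Up (m + 1) - Up m := rfl
    rw [e]
    linear_combination 2 * h

theorem Up_sum (m : ℕ) :
    ∑ n ∈ Finset.range m, (Up (n + 1) + Up n) * (2 - Polynomial.X) =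
      2 - Up (m + 1) + (Polynomial.X * Up m - Up (m + 1)) := by
  induction m with
  | zero => simp [Up]; norm_num
  | succ m ih =>
    rw [Finset.sum_range_succ, ih]
    have e : Up (m + 1 + 1) = Polynomial.X * Up (m + 1) - Up m := rfl
    rw [e]
    ring

section mat
variable [Fintype I] [DecidableEq I] (A : I → I → ℤ)

/-- The matrices `X_n`. -/
def XM (n : ℕ) : Matrix I I ℤ := Polynomial.aeval (Matrix.of A) (Up n)

theorem XM_rec (n : ℕ) : XM A (n + 2) = Matrix.of A * XM A (n + 1) - XM A n := by
  simp [XM, Up]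

theorem XM_comm (n : ℕ) : Matrix.of A * XM A n = XM A n * Matrix.of A := by
  have : Polynomial.aeval (Matrix.of A) (Polynomial.X * Up n) =
    Polynomial.aeval (Matrix.of A) (Up n * Polynomial.X) := by rw [mul_comm]
  simpa [XM] using this

theorem XM_xs (n : ℕ) (i j : I) : XM A n i j = xs (fun _ => 1) A j n i := by
  induction n using Nat.strong_induction_on generalizing i with
  | _ n ih =>
  match n with
  | 0 => simp [XM, Up, xs]
  | 1 => simp [XM, Up, xs, Matrix.one_apply, Pi.single_apply]
  | n + 2 =>
    rw [XM_rec, Matrix.sub_apply, Matrix.mul_apply, ih n (by omega)]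
    simp only [xs]
    rw [Finset.sum_congr rfl (fun k _ => by rw [ih (n + 1) (by omega) k])]
    simp
    ring

theorem XM_symm (d : I → ℤ) (hd : ∀ i j, d i * A i j = d j * A j i) (n : ℕ) (i j : I) :
    d i * XM A n i j = d j * XM A n j i := by
  induction n using Nat.strong_induction_on generalizing i j with
  | _ n ih =>
  match n with
  | 0 => simp [XM, Up]
  | 1 =>
    by_cases h : i = j
    · subst h; rfl
    · simp [XM, Up, h, Ne.symm h]
  | n + 2 =>
    have h1 := ih n (by omega) i j
    conv_rhs => rw [XM_rec, XM_comm]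
    rw [XM_rec]
    simp only [Matrix.sub_apply, Matrix.mul_apply, Matrix.of_apply, mul_sub, h1, Finset.mul_sum]
    congr 1
    apply Finset.sum_congr rfl
    intro k _
    have h2 := ih (n + 1) (by omega) k j
    linear_combination XM A (n + 1) k j * hd i k + A k i * h2

/-- the Cartan matrix applied to a vector -/
def cv (y : I → ℤ) (i : I) : ℤ := 2 * y i - ∑ k, A i k * y k

/-- the bilinear form -/
def frm (d : I → ℤ) (x y : I → ℤ) : ℤ := ∑ i, d i * x i * cv A y i

theorem cv_eq (y : I → ℤ) : cv A y = (2 - Matrix.of A).mulVec y := by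
  ext i
  rw [Matrix.sub_mulVec]
  simp [cv, Matrix.mulVec, dotProduct, Matrix.ofNat_apply, Matrix.diagonal_apply]

theorem count_bound (d : I → ℤ) (hd : ∀ i j, d i * A i j = d j * A j i) (hdpos : ∀ i, 0 < d i)
    (θ : I → ℤ) (hθ : ∀ i, 0 ≤ θ i) (dθ : ℤ) (hdθ : 0 < dθ)
    (hdom : ∀ i, 0 ≤ cv A θ i) (hnorm : frm A d θ θ = 2 * dθ)
    (hintg : ∀ y, dθ ∣ frm A d y θ)
    (m : ℕ) (hpos : ∀ n < m, ∀ i j, 0 ≤ (XM A (n + 1) + XM A n) i j)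
    (hm0 : XM A m = 0) (hZ : ∀ i j, 0 ≤ - XM A (m + 1) i j)
    (n1 n2 : ℕ) (j1 j2 : I) (hne : (n1, j1) ≠ (n2, j2)) (hn1 : n1 < m) (hn2 : n2 < m)
    (h1 : ∀ i, (XM A (n1 + 1) + XM A n1) i j1 = θ i)
    (h2 : ∀ i, (XM A (n2 + 1) + XM A n2) i j2 = θ i)
    (hd1 : d j1 = dθ) (hd2 : d j2 = dθ) :
    1 + ∑ i, θ i ≤ m := by
  set Y : ℕ → Matrix I I ℤ := fun n => XM A (n + 1) + XM A n with hY
  set g : ℕ → I → ℤ := fun n => (Y n).mulVec (cv A θ) with hg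
  have hYs : ∀ n i j, d i * Y n i j = d j * Y n j i := by
    intro n i j
    simp only [hY, Matrix.add_apply, mul_add]
    rw [XM_symm A d hd (n + 1), XM_symm A d hd n]
  -- the pairing
  have hpair : ∀ n j, frm A d (fun i => Y n i j) θ = d j * g n j := by
    intro n j
    simp only [frm, hg, Matrix.mulVec, dotProduct, Finset.mul_sum]
    apply Finset.sum_congr rfl
    intro i _
    linear_combination cv A θ i * hYs n i j
  have hgpos : ∀ n < m, ∀ j, 0 ≤ g n j := by
    intro n hn j
    exact Finset.sum_nonneg (fun i _ => mul_nonneg (hpos n hn j i) (hdom i))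
  have hS2 : ∑ n ∈ Finset.range m, (Y n * Y n) * (2 - Matrix.of A) = 2 * (m : Matrix I I ℤ) := by
    have := congrArg (Polynomial.aeval (Matrix.of A)) (Up_sum_sq m)
    simp only [map_sum, map_mul, map_pow, map_add, map_sub, Polynomial.aeval_X, map_ofNat,
      map_natCast] at this
    change ∑ n ∈ Finset.range m, (XM A (n + 1) + XM A n) ^ 2 * (2 - Matrix.of A) = _ + XM A m * _
      at this
    rw [hm0, zero_mul, add_zero] at this
    simpa [sq] using this
  have hS1 : ∑ n ∈ Finset.range m, Y n * (2 - Matrix.of A) = 2 - 2 * XM A (m + 1) := by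
    have := congrArg (Polynomial.aeval (Matrix.of A)) (Up_sum m)
    simp only [map_sum, map_mul, map_add, map_sub, Polynomial.aeval_X, map_ofNat] at this
    change ∑ n ∈ Finset.range m, (XM A (n + 1) + XM A n) * (2 - Matrix.of A) =
      2 - XM A (m + 1) + (_ * XM A m - XM A (m + 1)) at this
    rw [hm0, mul_zero] at this
    rw [this, two_mul]
    abel
  have hZ2 : XM A (m + 1) * XM A (m + 1) = 1 := by
    have := congrArg (Polynomial.aeval (Matrix.of A)) (Up_cassini m)
    simp only [map_mul, map_pow, map_add, map_sub, map_one] at this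
    change XM A (m + 1) ^ 2 + XM A m ^ 2 - _ * XM A m = 1 at this
    rw [hm0] at this
    simpa [sq] using this
  -- second moments
  have hsum2 : ∑ n ∈ Finset.range m, ∑ j, d j * g n j ^ 2 = 4 * m * dθ := by
    have e1 : ∀ n, ∑ j, d j * g n j ^ 2 = frm A d (((Y n * Y n) * (2 - Matrix.of A)).mulVec θ) θ := by
      intro n
      have : ((Y n * Y n) * (2 - Matrix.of A)).mulVec θ = (Y n).mulVec (g n) := by
        rw [hg]
        simp only [cv_eq, Matrix.mulVec_mulVec, mul_assoc]
      rw [this]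
      have e2 : ∀ j, d j * g n j ^ 2 = ∑ i, d i * (Y n i j * g n j) * cv A θ i := by
        intro j
        have := hpair n j
        rw [sq, ← mul_assoc, ← this, frm, Finset.sum_mul]
        exact Finset.sum_congr rfl (fun i _ => by ring)
      simp only [e2]
      rw [Finset.sum_comm]
      simp only [frm, Matrix.mulVec, dotProduct, Finset.mul_sum, Finset.sum_mul]
    simp only [e1]
    have e3 : ∀ s : Finset ℕ, ∀ f : ℕ → I → ℤ, ∑ n ∈ s, frm A d (f n) θ =
        frm A d (∑ n ∈ s, f n) θ := by
      intro s f
      simp only [frm]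
      rw [Finset.sum_comm]
      apply Finset.sum_congr rfl
      intro i _
      rw [Finset.sum_apply, Finset.mul_sum, Finset.sum_mul]
    rw [e3, ← Matrix.sum_mulVec, hS2]
    have e4 : (2 * (m : Matrix I I ℤ)).mulVec θ = (2 * (m : ℤ)) • θ := by
      have : (2 * (m : Matrix I I ℤ)) = (2 * (m : ℤ)) • (1 : Matrix I I ℤ) := by
        simp [two_mul, add_smul]
      rw [this, Matrix.smul_mulVec, Matrix.one_mulVec]
    rw [e4]
    have e5 : frm A d ((2 * (m : ℤ)) • θ) θ = 2 * m * frm A d θ θ := by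
      simp only [frm, Finset.mul_sum, Pi.smul_apply, smul_eq_mul]
      exact Finset.sum_congr rfl (fun i _ => by ring)
    rw [e5, hnorm]
    ring
  have hsum1 : ∑ n ∈ Finset.range m, ∑ j, g n j =
      2 * ∑ i, θ i + 2 * ∑ i, (-(XM A (m + 1))).mulVec θ i := by
    have e1 : ∀ n, g n = (Y n * (2 - Matrix.of A)).mulVec θ := by
      intro n
      simp only [hg, cv_eq, Matrix.mulVec_mulVec]
    rw [Finset.sum_comm]
    have e2 : ∀ j, ∑ n ∈ Finset.range m, g n j = 2 * θ j + 2 * (-(XM A (m + 1))).mulVec θ j := by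
      intro j
      simp only [e1]
      rw [← Finset.sum_apply, ← Matrix.sum_mulVec, hS1, Matrix.sub_mulVec, two_mul,
        Matrix.add_mulVec, Matrix.neg_mulVec]
      have : (2 : Matrix I I ℤ).mulVec θ = (2 : ℤ) • θ := by
        have : (2 : Matrix I I ℤ) = (2 : ℤ) • (1 : Matrix I I ℤ) := by
          rw [two_smul]; norm_num
        rw [this, Matrix.smul_mulVec, Matrix.one_mulVec]
      rw [this]
      simp
      ring
    simp only [e2, Finset.sum_add_distrib, Finset.mul_sum]
  have hcol : ∀ j, 1 ≤ ∑ i, -(XM A (m + 1)) i j := by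
    intro j
    by_contra hcon
    have h0 : ∑ i, -(XM A (m + 1)) i j = 0 := by
      have : 0 ≤ ∑ i, -(XM A (m + 1)) i j := Finset.sum_nonneg (fun i _ => hZ i j)
      omega
    rw [Finset.sum_eq_zero_iff_of_nonneg (fun i _ => hZ i j)] at h0
    have h3 := congrFun (congrFun hZ2 j) j
    rw [Matrix.mul_apply, Finset.sum_eq_zero] at h3
    · simp at h3
    · intro k _
      have := h0 k (Finset.mem_univ k)
      rw [neg_eq_zero] at this
      rw [this, mul_zero]
  have hZθ : ∑ i, θ i ≤ ∑ i, (-(XM A (m + 1))).mulVec θ i := by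
    simp only [Matrix.mulVec, dotProduct]
    rw [Finset.sum_comm]
    apply Finset.sum_le_sum
    intro j _
    rw [← Finset.sum_mul]
    have := mul_le_mul_of_nonneg_right (hcol j) (hθ j)
    simpa using this
  -- pointwise
  have hpt : ∀ n < m, ∀ j, 0 ≤ d j * g n j ^ 2 - dθ * g n j := by
    intro n hn j
    obtain ⟨k, hk⟩ := hintg (fun i => Y n i j)
    rw [hpair] at hk
    have hg0 := hgpos n hn j
    rcases hg0.eq_or_lt with h | h
    · rw [← h]; simp
    · have hk1 : 0 < k := by
        by_contra hk0
        have : d j * g n j ≤ 0 := by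
          rw [hk]; exact mul_nonpos_of_nonneg_of_nonpos hdθ.le (by omega)
        have := mul_pos (hdpos j) h
        omega
      have : d j * g n j ^ 2 = dθ * k * g n j := by rw [← hk]; ring
      rw [this]
      have h5 : 0 ≤ dθ * g n j * (k - 1) :=
        mul_nonneg (mul_nonneg hdθ.le hg0) (by omega)
      linarith
  have hocc : ∀ n j, d j = dθ → (∀ i, Y n i j = θ i) → d j * g n j ^ 2 - dθ * g n j = 2 * dθ := by
    intro n j hdj hy
    have := hpair n j
    have e : (fun i => Y n i j) = θ := funext hy
    rw [e, hnorm, hdj] at this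
    have h2 : g n j = 2 := by
      have : dθ * (g n j - 2) = 0 := by linarith
      rcases mul_eq_zero.1 this with h | h <;> omega
    rw [h2, hdj]; ring
  have htot : 4 * dθ ≤ ∑ x ∈ Finset.range m ×ˢ (Finset.univ : Finset I),
      (d x.2 * g x.1 x.2 ^ 2 - dθ * g x.1 x.2) := by
    have hsub : ({(n1, j1), (n2, j2)} : Finset (ℕ × I)) ⊆ Finset.range m ×ˢ Finset.univ := by
      intro x hx
      simp only [Finset.mem_insert, Finset.mem_singleton] at hx
      rcases hx with rfl | rfl <;> simp [hn1, hn2]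
    have h6 := Finset.sum_le_sum_of_subset_of_nonneg
      (f := fun x : ℕ × I => d x.2 * g x.1 x.2 ^ 2 - dθ * g x.1 x.2) hsub
      (fun x hx _ => hpt x.1 (by simpa using hx) x.2)
    rw [Finset.sum_pair hne] at h6
    simp only at h6
    rw [hocc n1 j1 hd1 h1, hocc n2 j2 hd2 h2] at h6
    linarith
  rw [Finset.sum_product] at htot
  simp only [Finset.sum_sub_distrib, ← Finset.mul_sum] at htot
  rw [hsum2, hsum1] at htot
  have : dθ * (1 + ∑ i, θ i) ≤ dθ * m := by
    have := mul_le_mul_of_nonneg_left hZθ hdθ.le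
    nlinarith
  exact le_of_mul_le_mul_left this hdθ

end mat

section form
variable [Fintype I] [DecidableEq I] (A : I → I → ℤ) (d : I → ℤ)

theorem frm_single_left (i : I) (y : I → ℤ) :
    frm A d (Pi.single i 1) y = d i * cv A y i := by
  unfold frm
  rw [Finset.sum_eq_single i]
  · simp
  · intro b _ hb; simp [hb]
  · simp

theorem frm_symm (hd : ∀ i j, d i * A i j = d j * A j i) (x y : I → ℤ) :
    frm A d x y = frm A d y x := by
  have key : ∀ x y : I → ℤ, frm A d x y = ∑ i, 2 * d i * x i * y i -
      ∑ i, ∑ k, d i * A i k * x i * y k := by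
    intro x y
    unfold frm cv
    rw [← Finset.sum_sub_distrib]
    apply Finset.sum_congr rfl
    intro i _
    rw [mul_sub, Finset.mul_sum]
    congr 1
    · ring
    · apply Finset.sum_congr rfl; intros; ring
  rw [key, key]
  congr 1
  · apply Finset.sum_congr rfl; intros; ring
  · rw [Finset.sum_comm]
    apply Finset.sum_congr rfl; intro i _
    apply Finset.sum_congr rfl; intro k _
    rw [hd k i]; ring

theorem frm_add_smul (x z y : I → ℤ) (a : ℤ) :
    frm A d (x + a • z) y = frm A d x y + a * frm A d z y := by
  unfold frm
  rw [Finset.mul_sum, ← Finset.sum_add_distrib]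
  apply Finset.sum_congr rfl
  intros
  simp
  ring

theorem s_eq (i : I) (x : I → ℤ) :
    Tg (fun _ => 1) A i x = x + (- cv A x i) • Pi.single i 1 := by
  rw [Tg_apply, gfun_apply]
  congr 2
  unfold cv
  ring

theorem frm_s (hd : ∀ i j, d i * A i j = d j * A j i) (i : I) (x y : I → ℤ) :
    frm A d (Tg (fun _ => 1) A i x) y = frm A d x (Tg (fun _ => 1) A i y) := by
  rw [frm_symm A d hd x, s_eq, s_eq, frm_add_smul, frm_add_smul, frm_single_left, frm_single_left,
    frm_symm A d hd x]
  ring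

theorem frm_sact (hd : ∀ i j, d i * A i j = d j * A j i) (L : List I) (x y : I → ℤ) :
    frm A d (sact A L x) y = frm A d x (sact A L.reverse y) := by
  induction L generalizing x y with
  | nil => simp [sact]
  | cons a L ih =>
    rw [List.reverse_cons, sact_append, Module.End.mul_apply, sact_single, ← ih, ← frm_s A d hd,
      sact, act_cons, Module.End.mul_apply]
    rfl

theorem sact_rev_apply (hA : ∀ i, A i i = 0) (L : List I) (x : I → ℤ) :
    sact A L.reverse (sact A L x) = x := by
  rw [← Module.End.mul_apply, sact_rev A hA]; rfl

theorem sact_rev_apply' (hA : ∀ i, A i i = 0) (L : List I) (x : I → ℤ) :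
    sact A L (sact A L.reverse x) = x := by
  have := sact_rev_apply A hA L.reverse x
  rwa [List.reverse_reverse] at this

theorem frm_root (hA : ∀ i, A i i = 0) (hd : ∀ i j, d i * A i j = d j * A j i) (L : List I) (j : I) :
    frm A d (sact A L (Pi.single j 1)) (sact A L (Pi.single j 1)) = 2 * d j := by
  rw [frm_sact A d hd, sact_rev_apply A hA, frm_single_left]
  simp [cv, Pi.single_apply, hA]
  ring

theorem frm_root_dvd (hd : ∀ i j, d i * A i j = d j * A j i) (L : List I) (j : I)
    (y : I → ℤ) : d j ∣ frm A d y (sact A L (Pi.single j 1)) := by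
  rw [frm_symm A d hd, frm_sact A d hd, frm_single_left]
  exact dvd_mul_right _ _

end form

section main
variable [Fintype I] [DecidableEq I] (A : I → I → ℤ)

theorem occur (hA : ∀ i, A i i = 0) (ε : I → Bool) (hε : ∀ i k, ε i = ε k → A i k = 0)
    (hsign : ∀ L j, 0 ≤ sact A L (Pi.single j 1) ∨ sact A L (Pi.single j 1) ≤ 0)
    (θ : I → ℤ) (L0 : List I) (j0 : I) (hθ : θ = sact A L0 (Pi.single j0 1))
    (hθ0 : 0 ≤ θ) (m : ℕ)
    (hpos : ∀ j, 0 ≤ xs (fun _ => 1) A j m) 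
    (hm0 : ∀ j, xs (fun _ => 1) A j (m + 1) = 0) (hm2 : ∀ j, xs (fun _ => 1) A j (m + 2) ≤ 0)
    (b : Bool) :
    ∃ k < m + 1, ∃ j, b = not^[k] (ε j) ∧ sact A (Bw ε k b) (Pi.single j 1) = θ ∧
      xs (fun _ => 1) A j (k + 1) + xs (fun _ => 1) A j k = θ := by
  have hθne : θ ≠ 0 := by rw [hθ]; exact sact_single_ne A hA L0 j0
  set z : ℕ → I → ℤ := fun k => sact A (Bw ε k b).reverse θ with hz
  have hz0 : z 0 = θ := by simp [hz, Bw, sact]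
  have hw : ∀ j, sact A (Bw ε (m + 1) b) (Pi.single j 1) ≤ 0 := by
    intro j
    by_cases hj : ε j = not^[m + 1] b
    · have := act_Bw (fun _ => 1) A ε hε j (m + 1)
      rw [hj, not_iter_iter] at this
      rw [sact, this, hm0, add_zero]
      exact hm2 j
    · have hj' : ε j = not^[m] b := by
        rw [Function.iterate_succ_apply'] at hj
        generalize not^[m] b = c at *
        cases c <;> simp_all
      rw [Bw_succ, sact_append, Module.End.mul_apply]
      have e : sact A (cls ε (not^[m] b)) (Pi.single j 1) = - Pi.single j 1 := by
        ext k
        rw [sact, act_cls _ A ε hε]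
        by_cases hk : ε k = not^[m] b
        · simp [hk, Pi.single_apply, hε k j (by rw [hk, hj'])]
          split_ifs <;> simp
        · have : k ≠ j := by rintro rfl; exact hk hj'
          simp [hk, this]
      have := act_Bw (fun _ => 1) A ε hε j m
      rw [hj', not_iter_iter, hm0, zero_add] at this
      rw [e, map_neg, sact, this]
      simpa using hpos j
  have hnot : ¬ ∀ k ≤ m + 1, 0 ≤ z k := by
    intro h
    have h1 := h (m + 1) le_rfl
    have h2 : sact A (Bw ε (m + 1) b) (z (m + 1)) = θ := sact_rev_apply' A hA _ _
    rw [← Finset.univ_sum_single (z (m + 1)), map_sum] at h2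
    have h3 : θ ≤ 0 := by
      rw [← h2]
      apply Finset.sum_nonpos
      intro i _
      have : (Pi.single i (z (m + 1) i) : I → ℤ) = z (m + 1) i • Pi.single i 1 := by
        rw [← Pi.single_smul]; simp
      rw [this, map_smul]
      exact smul_nonpos_of_nonneg_of_nonpos (h1 i) (hw i)
    exact hθne (le_antisymm h3 hθ0)
  have hroot : ∀ M, 0 ≤ sact A M θ ∨ sact A M θ ≤ 0 := by
    intro M
    have := hsign (M ++ L0) j0
    rwa [sact_append, Module.End.mul_apply, ← hθ] at this
  obtain ⟨k, hk, hzk, hzk1⟩ : ∃ k < m + 1, 0 ≤ z k ∧ ¬ 0 ≤ z (k + 1) := by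
    by_contra hcon
    push Not at hcon
    apply hnot
    intro k
    induction k with
    | zero => intro _; rw [hz0]; exact hθ0
    | succ k ih => intro h; exact hcon k (by omega) (ih (by omega))
  have hzk2 : z (k + 1) ≤ 0 := (hroot _).resolve_left hzk1
  have hstep : ∀ i, ε i ≠ not^[k] b → z (k + 1) i = z k i := by
    intro i hi
    simp only [hz]
    rw [Bw_succ, List.reverse_append, sact_append, Module.End.mul_apply]
    rw [sact, act_class _ A ε hε (not^[k] b) (cls ε (not^[k] b)).reverse (List.nodup_reverse.2 (Finset.nodup_toList _))
      (by simp [cls])]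
    simp [cls, hi]
  have hsup : ∀ i, ε i ≠ not^[k] b → z k i = 0 := by
    intro i hi
    exact le_antisymm (hstep i hi ▸ hzk2 i) (hzk i)
  have hzne : z k ≠ 0 := by
    intro h
    exact hθne (sact_inj A hA _ _ h)
  obtain ⟨i, hi⟩ : ∃ i, z k i ≠ 0 := by
    by_contra hcon; push Not at hcon; exact hzne (funext hcon)
  have hip : 0 < z k i := lt_of_le_of_ne (hzk i) hi.symm
  have hic : ε i = not^[k] b := by by_contra h; exact hi (hsup i h)
  have hsz : sact A (i :: (Bw ε k b).reverse) θ = Tg (fun _ => 1) A i (z k) := by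
    rw [sact, act_cons]; rfl
  have hszi : Tg (fun _ => 1) A i (z k) i = - z k i := by
    rw [Tg_apply']
    have : ∑ j, A i j * z k j = 0 := by
      apply Finset.sum_eq_zero
      intro j _
      by_cases hj : ε j = not^[k] b
      · rw [hε i j (by rw [hic, hj]), zero_mul]
      · rw [hsup j hj, mul_zero]
    simp [this]
  have hneg : Tg (fun _ => 1) A i (z k) ≤ 0 := by
    rw [← hsz]
    refine (hroot _).resolve_left ?_
    intro h
    have := h i
    rw [hsz, hszi] at this
    simp at this
    omega
  have hoth : ∀ j, j ≠ i → z k j = 0 := by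
    intro j hj
    have := hneg j
    rw [Tg_apply', if_neg hj] at this
    exact le_antisymm this (hzk j)
  have hzi : z k = z k i • Pi.single i 1 := by
    ext j
    by_cases hj : j = i
    · subst hj; simp
    · simp [hj, hoth j hj]
  have hone : z k i = 1 := by
    have h1 : sact A ((Bw ε k b).reverse ++ L0).reverse (z k) = Pi.single j0 1 := by
      simp only [hz]
      rw [hθ, ← Module.End.mul_apply (sact A (Bw ε k b).reverse), ← sact_append,
        sact_rev_apply A hA]
    rw [hzi, map_smul] at h1
    have h2 := congrFun h1 j0
    simp only [Pi.smul_apply, smul_eq_mul, Pi.single_eq_same] at h2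
    have h3 : z k i ∣ 1 := ⟨_, h2.symm⟩
    have := Int.le_of_dvd one_pos h3
    omega
  rw [hone, one_smul] at hzi
  have hfin : sact A (Bw ε k b) (Pi.single i 1) = θ := by
    rw [← hzi]; exact sact_rev_apply' A hA _ _
  refine ⟨k, hk, i, by rw [hic, not_iter_iter], hfin, ?_⟩
  have := act_Bw (fun _ => 1) A ε hε i k
  rw [hic, not_iter_iter] at this
  rw [← this]; exact hfin

theorem main_pos (hA : ∀ i, A i i = 0) (hAnn : ∀ i j, 0 ≤ A i j) (d : I → ℤ)
    (hd : ∀ i j, d i * A i j = d j * A j i) (hdpos : ∀ i, 0 < d i)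
    (hconn : ∀ i j : I, Relation.ReflTransGen (fun a b => A a b ≠ 0) i j)
    (ε : I → Bool) (hε : ∀ i k, ε i = ε k → A i k = 0)
    (hsign : ∀ L j, 0 ≤ sact A L (Pi.single j 1) ∨ sact A L (Pi.single j 1) ≤ 0)
    (θ : I → ℤ) (L0 : List I) (j0 : I) (hθ : θ = sact A L0 (Pi.single j0 1))
    (hhigh : ∀ L j, sact A L (Pi.single j 1) ≤ θ) (n : ℕ) (hn : (n : ℤ) < 1 + ∑ i, θ i) (j : I) :
    0 ≤ xs (fun _ => 1) A j (n + 1) + xs (fun _ => 1) A j n := by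
  classical
  have hθ1 : ∀ i, 1 ≤ θ i := by
    intro i
    have := hhigh [] i i
    simpa [sact] using this
  have hθ0 : 0 ≤ θ := fun i => le_trans zero_le_one (hθ1 i)
  by_contra hcon
  have hex : ∃ m, ∃ j, ¬ 0 ≤ xs (fun _ => 1) A j (m + 1) + xs (fun _ => 1) A j m := ⟨n, j, hcon⟩
  set m := Nat.find hex with hm
  have hmn : m ≤ n := Nat.find_min' hex ⟨j, hcon⟩
  obtain ⟨a, ha⟩ := Nat.find_spec hex
  rw [← hm] at ha
  have hlt : ∀ k < m, ∀ j, 0 ≤ xs (fun _ => 1) A j (k + 1) + xs (fun _ => 1) A j k := by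
    intro k hk j
    have := Nat.find_min hex hk
    push Not at this
    exact this j
  have hm1 : m ≠ 0 := by
    intro h0
    rw [h0] at ha
    apply ha
    simp only [xs]
    intro k
    by_cases hk : k = a <;> simp [Pi.single_apply, hk]
  obtain ⟨m', hm'⟩ := Nat.exists_eq_succ_of_ne_zero hm1
  rw [Nat.succ_eq_add_one] at hm'
  clear_value m
  subst hm'
  have hnn : ∀ k < m' + 1, ∀ j i, 0 ≤ xs (fun _ => 1) A j (k + 1) i ∧ 0 ≤ xs (fun _ => 1) A j k i := by
    intro k hk j i
    have := hlt k hk j i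
    simp only [Pi.add_apply, Pi.zero_apply] at this
    rcases xs_split (fun _ => 1) A ε hε j k i with h | h <;> rw [h] at this ⊢ <;> simpa using this
  have hXnn : ∀ j i, 0 ≤ xs (fun _ => 1) A j (m' + 1) i := fun j i => (hnn m' (by omega) j i).1
  have hya : xs (fun _ => 1) A a (m' + 2) + xs (fun _ => 1) A a (m' + 1) ≤ 0 := by
    have := hsign (Bw ε (m' + 1) (not^[m' + 1] (ε a))) a
    rw [sact, act_Bw _ A ε hε] at this
    exact this.resolve_left ha
  have hcol : ∀ i, XM A (m' + 1) i a = 0 := by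
    intro i
    rw [XM_xs]
    have h1 := hya i
    simp only [Pi.add_apply, Pi.zero_apply] at h1
    rcases xs_split (fun _ => 1) A ε hε a (m' + 1) i with h | h
    · rw [h, zero_add] at h1
      exact le_antisymm h1 (hXnn a i)
    · exact h
  have hall : ∀ b, ∀ i, XM A (m' + 1) i b = 0 := by
    intro b
    induction hconn a b with
    | refl => exact hcol
    | @tail x y _ hxy ih =>
      intro i
      have h1 := congrFun (congrFun (XM_comm A (m' + 1)) i) x
      rw [Matrix.mul_apply, Matrix.mul_apply, Finset.sum_eq_zero (fun k _ => by rw [ih, mul_zero])] at h1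
      have h2 := (Finset.sum_eq_zero_iff_of_nonneg (fun k _ => by
        rw [XM_xs]; exact mul_nonneg (hXnn _ _) (hAnn _ _))).1 h1.symm y (Finset.mem_univ _)
      have h3 : A y x ≠ 0 := by
        intro h
        have := hd x y
        rw [h, mul_zero] at this
        rcases mul_eq_zero.1 this with h | h
        · exact absurd h (hdpos x).ne'
        · exact hxy h
      exact (mul_eq_zero.1 h2).resolve_right h3
  have hm0 : XM A (m' + 1) = 0 := by ext i b; exact hall b i
  have hm2 : XM A (m' + 2) = - XM A m' := by rw [XM_rec, hm0]; simp
  have hpm : ∀ j, 0 ≤ xs (fun _ => 1) A j m' := fun j i => (hnn m' (by omega) j i).2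
  have hX0 : ∀ j, xs (fun _ => 1) A j (m' + 1) = 0 := by
    intro j; ext i; rw [← XM_xs, hm0]; rfl
  have hX2 : ∀ j, xs (fun _ => 1) A j (m' + 2) ≤ 0 := by
    intro j i; rw [← XM_xs, hm2, Matrix.neg_apply, XM_xs]
    have := hpm j i
    simpa using this
  obtain ⟨k1, hk1, j1, e1, r1, y1⟩ := occur A hA ε hε hsign θ L0 j0 hθ hθ0 m' hpm hX0 hX2 true
  obtain ⟨k2, hk2, j2, e2, r2, y2⟩ := occur A hA ε hε hsign θ L0 j0 hθ hθ0 m' hpm hX0 hX2 false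
  have hnorm := frm_root A d hA hd L0 j0
  have n1 := frm_root A d hA hd (Bw ε k1 true) j1
  have n2 := frm_root A d hA hd (Bw ε k2 false) j2
  rw [r1, hθ, hnorm] at n1
  rw [r2, hθ, hnorm] at n2
  have := count_bound A d hd hdpos θ hθ0 (d j0) (hdpos j0) (by
      intro i
      have := hhigh (i :: L0) j0 i
      rw [sact, act_cons, Module.End.mul_apply] at this
      change Tg _ A i (sact A L0 _) i ≤ _ at this
      rw [← hθ, s_eq] at this
      simp at this
      exact this) (by rw [hθ]; exact hnorm)
      (by rw [hθ]; exact frm_root_dvd A d hd L0 j0) (m' + 1)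
      (by
        intro n hn i j
        rw [Matrix.add_apply, XM_xs, XM_xs]
        exact hlt n hn j i) hm0
      (by
        intro i j
        rw [hm2, Matrix.neg_apply, neg_neg, XM_xs]
        exact hpm j i) k1 k2 j1 j2
      (by
        intro h
        rw [Prod.mk.injEq] at h
        rw [← h.1, ← h.2, ← e1] at e2
        simp at e2) hk1 hk2
      (by intro i; rw [Matrix.add_apply, XM_xs, XM_xs, ← y1]; rfl)
      (by intro i; rw [Matrix.add_apply, XM_xs, XM_xs, ← y2]; rfl)
      (by linarith) (by linarith)
  have h5 : ((m' + 1 : ℕ) : ℤ) ≤ n := by exact_mod_cast hmn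
  linarith

end main

/-- Positive definiteness of a connected quasi-dominant form. -/
theorem posdef_real [Fintype I] (S : I → I → ℝ) (D θ : I → ℝ) (hS : ∀ i k, S i k = S k i)
    (hS0 : ∀ i k, 0 ≤ S i k) (hθ : ∀ i, 0 < θ i)
    (hdom : ∀ i, 0 ≤ D i * θ i - ∑ k, S i k * θ k)
    (hnorm : 0 < ∑ i, D i * θ i ^ 2 - ∑ i, ∑ k, S i k * θ i * θ k)
    (hconn : ∀ i j : I, Relation.ReflTransGen (fun a b => S a b ≠ 0) i j)
    (x : I → ℝ) (hx : ∃ i, x i ≠ 0) :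
    0 < ∑ i, D i * x i ^ 2 - ∑ i, ∑ k, S i k * x i * x k := by
  set u : I → ℝ := fun i => x i / θ i with hu
  have hxu : ∀ i, x i = θ i * u i := by
    intro i; simp only [hu]; field_simp [(hθ i).ne']
  have e1 : ∑ i, ∑ k, S i k * θ i * θ k * u k ^ 2 = ∑ i, ∑ k, S i k * θ i * θ k * u i ^ 2 := by
    rw [Finset.sum_comm]
    apply Finset.sum_congr rfl; intro i _
    apply Finset.sum_congr rfl; intro k _
    rw [hS]; ring
  have key : ∑ i, D i * x i ^ 2 - ∑ i, ∑ k, S i k * x i * x k =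
      ∑ i, θ i * u i ^ 2 * (D i * θ i - ∑ k, S i k * θ k) +
        (∑ i, ∑ k, S i k * θ i * θ k * (u i - u k) ^ 2) / 2 := by
    have e2 : ∑ i, ∑ k, S i k * θ i * θ k * (u i - u k) ^ 2 =
        ∑ i, ∑ k, S i k * θ i * θ k * u i ^ 2 + ∑ i, ∑ k, S i k * θ i * θ k * u k ^ 2
          - 2 * ∑ i, ∑ k, S i k * x i * x k := by
      rw [Finset.mul_sum, ← Finset.sum_add_distrib, ← Finset.sum_sub_distrib]
      apply Finset.sum_congr rfl; intro i _
      rw [Finset.mul_sum, ← Finset.sum_add_distrib, ← Finset.sum_sub_distrib]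
      apply Finset.sum_congr rfl; intro k _
      rw [hxu i, hxu k]; ring
    have e3 : ∑ i, θ i * u i ^ 2 * (D i * θ i - ∑ k, S i k * θ k) =
        ∑ i, D i * x i ^ 2 - ∑ i, ∑ k, S i k * θ i * θ k * u i ^ 2 := by
      rw [← Finset.sum_sub_distrib]
      apply Finset.sum_congr rfl; intro i _
      rw [mul_sub, Finset.mul_sum]
      congr 1
      · rw [hxu]; ring
      · apply Finset.sum_congr rfl; intros; ring
    rw [e2, e3, e1]; ring
  have t1 : ∀ i ∈ Finset.univ, 0 ≤ θ i * u i ^ 2 * (D i * θ i - ∑ k, S i k * θ k) := fun i _ =>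
    mul_nonneg (mul_nonneg (hθ i).le (sq_nonneg _)) (hdom i)
  have t2 : ∀ i k, 0 ≤ S i k * θ i * θ k * (u i - u k) ^ 2 := fun i k =>
    mul_nonneg (mul_nonneg (mul_nonneg (hS0 i k) (hθ i).le) (hθ k).le) (sq_nonneg _)
  have s1 := Finset.sum_nonneg t1
  have s2 : 0 ≤ ∑ i, ∑ k, S i k * θ i * θ k * (u i - u k) ^ 2 :=
    Finset.sum_nonneg fun i _ => Finset.sum_nonneg fun k _ => t2 i k
  by_contra hcon
  rw [key] at hcon
  have z1 : ∑ i, θ i * u i ^ 2 * (D i * θ i - ∑ k, S i k * θ k) = 0 := by linarith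
  have z2 : ∑ i, ∑ k, S i k * θ i * θ k * (u i - u k) ^ 2 = 0 := by linarith
  have hedge : ∀ a b, S a b ≠ 0 → u a = u b := by
    intro a b hab
    have h1 := (Finset.sum_eq_zero_iff_of_nonneg
      (fun i _ => Finset.sum_nonneg fun k _ => t2 i k)).1 z2 a (Finset.mem_univ _)
    have h2 := (Finset.sum_eq_zero_iff_of_nonneg (fun k _ => t2 a k)).1 h1 b (Finset.mem_univ _)
    have h3 : S a b * θ a * θ b ≠ 0 := mul_ne_zero (mul_ne_zero hab (hθ a).ne') (hθ b).ne'
    have h4 := pow_eq_zero_iff (two_ne_zero) |>.1 ((mul_eq_zero.1 h2).resolve_left h3)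
    linarith
  obtain ⟨i0, hi0⟩ := hx
  have hconst : ∀ j, u j = u i0 := by
    intro j
    induction hconn i0 j with
    | refl => rfl
    | tail _ hxy ih => rw [← hedge _ _ hxy, ih]
  have hui : u i0 ≠ 0 := by
    intro h; apply hi0; rw [hxu, h, mul_zero]
  have e4 : ∑ i, θ i * u i ^ 2 * (D i * θ i - ∑ k, S i k * θ k) =
      u i0 ^ 2 * (∑ i, D i * θ i ^ 2 - ∑ i, ∑ k, S i k * θ i * θ k) := by
    rw [← Finset.sum_sub_distrib, Finset.mul_sum]
    apply Finset.sum_congr rfl; intro i _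
    rw [hconst i]
    have : ∑ k, S i k * θ i * θ k = θ i * ∑ k, S i k * θ k := by
      rw [Finset.mul_sum]; apply Finset.sum_congr rfl; intros; ring
    rw [this]; ring
  rw [e4] at z1
  have : 0 < u i0 ^ 2 * (∑ i, D i * θ i ^ 2 - ∑ i, ∑ k, S i k * θ i * θ k) :=
    mul_pos (by positivity) hnorm
  linarith

section fin
variable [Fintype I] [DecidableEq I] (A : I → I → ℤ)

theorem posdef_A (hAnn : ∀ i j, 0 ≤ A i j) (d : I → ℤ)
    (hd : ∀ i j, d i * A i j = d j * A j i) (hdpos : ∀ i, 0 < d i)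
    (hconn : ∀ i j : I, Relation.ReflTransGen (fun a b => A a b ≠ 0) i j)
    (θ : I → ℤ) (hθ1 : ∀ i, 1 ≤ θ i) (hdom : ∀ i, 0 ≤ cv A θ i) (hnorm : 0 < frm A d θ θ)
    (x : I → ℝ) (hx : ∃ i, x i ≠ 0) :
    0 < ∑ i, 2 * (d i : ℝ) * x i ^ 2 - ∑ i, ∑ k, (d i : ℝ) * A i k * x i * x k := by
  apply posdef_real (fun i k => (d i : ℝ) * A i k) (fun i => 2 * (d i : ℝ)) (fun i => (θ i : ℝ))
  · intro i k; exact_mod_cast hd i k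
  · intro i k; exact mul_nonneg (by exact_mod_cast (hdpos i).le) (by exact_mod_cast hAnn i k)
  · intro i; have := hθ1 i; exact_mod_cast (by omega : 0 < θ i)
  · intro i
    have h := mul_nonneg (hdpos i).le (hdom i)
    have e : d i * cv A θ i = 2 * d i * θ i - ∑ k, d i * A i k * θ k := by
      unfold cv; rw [mul_sub, Finset.mul_sum]
      congr 1
      · ring
      · apply Finset.sum_congr rfl; intros; ring
    rw [e] at h
    exact_mod_cast h
  · have e : frm A d θ θ = ∑ i, 2 * d i * θ i ^ 2 - ∑ i, ∑ k, d i * A i k * θ i * θ k := by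
      unfold frm cv
      rw [← Finset.sum_sub_distrib]
      apply Finset.sum_congr rfl; intro i _
      rw [mul_sub, Finset.mul_sum]
      congr 1
      · ring
      · apply Finset.sum_congr rfl; intros; ring
    rw [e] at hnorm
    exact_mod_cast hnorm
  · intro i j
    refine Relation.ReflTransGen.mono ?_ i j (hconn i j)
    intro a b hab
    have h1 : (d a : ℝ) ≠ 0 := by exact_mod_cast (hdpos a).ne'
    have h2 : (A a b : ℝ) ≠ 0 := by exact_mod_cast hab
    exact mul_ne_zero h1 h2
  · exact hx

theorem edge_bound (hA : ∀ i, A i i = 0) (d : I → ℤ) (r : ℤ) (hr : 0 < r)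
    (hpd : ∀ x : I → ℝ, (∃ i, x i ≠ 0) →
      0 < ∑ i, 2 * (d i : ℝ) * x i ^ 2 - ∑ i, ∑ k, (d i : ℝ) * A i k * x i * x k)
    (i j : I) (hij : i ≠ j) (h1 : d i = 1) (h2 : d j = r) (h3 : A i j = r) (h4 : A j i = 1) :
    r ≤ 3 := by
  have := hpd (fun k => if k = i then (r : ℝ) else if k = j then 2 else 0)
    ⟨j, by simp [hij.symm]⟩
  have hs : ∀ f : I → ℝ, (∀ k, k ≠ i → k ≠ j → f k = 0) → ∑ k, f k = f i + f j := by
    intro f hf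
    rw [← Finset.sum_pair hij]
    symm
    apply Finset.sum_subset (Finset.subset_univ _)
    intro k _ hk
    simp at hk
    exact hf k hk.1 hk.2
  rw [hs, hs, hs, hs] at this
  · simp [hij, hij.symm, hA, h1, h2, h3, h4] at this
    have h5 : r * r < 4 * r := by
      have : (r : ℝ) * r < 4 * r := by nlinarith
      exact_mod_cast this
    have : r < 4 := lt_of_mul_lt_mul_right h5 hr.le
    omega
  all_goals
    intros
    simp [*]

theorem bipart [Nonempty I] (hA : ∀ i, A i i = 0) (hAnn : ∀ i j, 0 ≤ A i j) (d : I → ℤ)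
    (hd : ∀ i j, d i * A i j = d j * A j i) (hdpos : ∀ i, 0 < d i)
    (hmax : ∀ i j, A i j ≠ 0 → d i * A i j = max (d i) (d j))
    (hconn : ∀ i j : I, Relation.ReflTransGen (fun a b => A a b ≠ 0) i j)
    (hpd : ∀ x : I → ℝ, (∃ i, x i ≠ 0) →
      0 < ∑ i, 2 * (d i : ℝ) * x i ^ 2 - ∑ i, ∑ k, (d i : ℝ) * A i k * x i * x k) :
    ∃ ε : I → Bool, ∀ i k, ε i = ε k → A i k = 0 := by
  classical
  have hsym : ∀ i j, A i j ≠ 0 → A j i ≠ 0 := by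
    intro i j h h'
    have := hd i j
    rw [h', mul_zero] at this
    rcases mul_eq_zero.1 this with h'' | h''
    · exact (hdpos i).ne' h''
    · exact h h''
  let G : SimpleGraph I :=
    { Adj := fun i j => A i j ≠ 0
      symm := ⟨fun i j h => hsym i j h⟩
      loopless := ⟨fun i h => h (hA i)⟩ }
  have hGc : G.Connected := by
    rw [SimpleGraph.connected_iff]
    refine ⟨fun i j => ?_, inferInstance⟩
    rw [SimpleGraph.reachable_iff_reflTransGen]
    exact hconn i j
  have hx := hpd (fun i => (Real.sqrt (d i))⁻¹) (by
    obtain ⟨i⟩ := ‹Nonempty I›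
    refine ⟨i, inv_ne_zero ?_⟩
    have : (0 : ℝ) < d i := by exact_mod_cast hdpos i
    exact (Real.sqrt_pos.2 this).ne')
  have hdp : ∀ i, (0 : ℝ) < d i := fun i => by exact_mod_cast hdpos i
  have e1 : ∑ i, 2 * (d i : ℝ) * (Real.sqrt (d i))⁻¹ ^ 2 = 2 * (Fintype.card I : ℝ) := by
    have : ∀ i, 2 * (d i : ℝ) * (Real.sqrt (d i))⁻¹ ^ 2 = 2 := by
      intro i
      rw [inv_pow, Real.sq_sqrt (hdp i).le, mul_assoc, mul_inv_cancel₀ (hdp i).ne', mul_one]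
    rw [Finset.sum_congr rfl (fun i _ => this i)]
    simp [mul_comm]
  have e2 : ∑ i, (G.degree i : ℝ) ≤
      ∑ i, ∑ k, (d i : ℝ) * A i k * (Real.sqrt (d i))⁻¹ * (Real.sqrt (d k))⁻¹ := by
    apply Finset.sum_le_sum
    intro i _
    have : (G.degree i : ℝ) = ∑ k, if A i k ≠ 0 then (1 : ℝ) else 0 := by
      rw [Finset.sum_boole, ← SimpleGraph.card_neighborFinset_eq_degree]
      congr 2
      ext k
      simp [G]
    rw [this]
    apply Finset.sum_le_sum
    intro k _
    have si := Real.sqrt_pos.2 (hdp i)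
    have sk := Real.sqrt_pos.2 (hdp k)
    split_ifs with h
    · have hm : (d i : ℝ) * A i k = max (d i : ℝ) (d k : ℝ) := by exact_mod_cast hmax i k h
      rw [hm, mul_assoc, ← mul_inv, ← div_eq_mul_inv, le_div_iff₀ (mul_pos si sk), one_mul]
      rcases le_total (d i : ℝ) (d k) with h' | h'
      · rw [max_eq_right h']
        calc _ ≤ Real.sqrt (d k) * Real.sqrt (d k) := by
              gcongr
          _ = _ := Real.mul_self_sqrt (hdp k).le
      · rw [max_eq_left h']
        calc _ ≤ Real.sqrt (d i) * Real.sqrt (d i) := by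
              gcongr
          _ = _ := Real.mul_self_sqrt (hdp i).le
    · push Not at h
      simp [h]
  have e3 : ∑ i, (G.degree i : ℝ) = 2 * G.edgeFinset.card := by
    exact_mod_cast G.sum_degrees_eq_twice_card_edges
  have hlt : G.edgeFinset.card < Fintype.card I := by
    have : (G.edgeFinset.card : ℝ) < Fintype.card I := by linarith
    exact_mod_cast this
  obtain ⟨T, hT, hTt⟩ := hGc.exists_isTree_le
  have hTc := hTt.card_edgeFinset
  have hsub : T.edgeFinset ⊆ G.edgeFinset := SimpleGraph.edgeFinset_mono hT
  have heq : T.edgeFinset = G.edgeFinset :=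
    Finset.eq_of_subset_of_card_le hsub (by omega)
  have hTG : T = G := SimpleGraph.edgeFinset_inj.1 heq
  rw [hTG] at hTt
  obtain ⟨col⟩ := hTt.colorable_two
  refine ⟨fun i => decide (col i = 0), ?_⟩
  intro i k hik
  by_contra h
  have h1 : col i ≠ col k := col.valid (show G.Adj i k from h)
  apply h1
  have h2 : (col i = 0) ↔ (col k = 0) := by simpa using hik
  revert h2
  generalize col i = a
  generalize col k = b
  revert a b
  decide
end fin

theorem hrk_of (A : I → I → ℤ) (d : I → ℤ) (r : ℤ)
    (hd : ∀ i j, d i * A i j = d j * A j i) (hdpos : ∀ i, 0 < d i)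
    (hone : ∀ i, d i = 1 ∨ d i = r)
    (hmax : ∀ i j, A i j ≠ 0 → d i * A i j = max (d i) (d j))
    (hr3 : ∀ i j, d i = 1 → d j = r → A i j = r → A j i = 1 → i ≠ j → r ≤ 3)
    {R : Type} [CommRing R] (P : Subsemiring R) (q q' : R) (hq : q * q' = 1) (h1 : q ∈ P)
    (h2 : q' ∈ P) (p : I → R) (B : I → I → R) (hp : ∀ i (n : ℕ), d i = n → p i = q ^ n)
    (hB0 : ∀ i j, i ≠ j → A i j = 0 → B i j = 0) (hB1 : ∀ i j, i ≠ j → A i j = 1 → B i j = 1)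
    (hB2 : ∀ i j, i ≠ j → A i j = 2 → B i j = q + q')
    (hB3 : ∀ i j, i ≠ j → A i j = 3 → B i j = q ^ 2 + 1 + q' ^ 2)
    (i j : I) (hij : i ≠ j) : ∃ m, RkPair A p B P i j m ∧ RkPair A p B P j i m := by
  have hz : ∀ i j, A i j = 0 → A j i = 0 := by
    intro i j h
    have := hd i j
    rw [h, mul_zero] at this
    exact (mul_eq_zero.1 this.symm).resolve_left (hdpos j).ne'
  have hspec : ∀ i j, i ≠ j → d i = 1 → d j = r → r ≠ 1 → A i j ≠ 0 →
      ∃ m, RkPair A p B P i j m ∧ RkPair A p B P j i m := by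
    intro i j hij hi hj hr hAij
    have hAji : A j i ≠ 0 := fun h => hAij (hz _ _ h)
    have hrp : 0 < r := hj ▸ hdpos j
    have e1 := hmax i j hAij
    have e2 := hmax j i hAji
    rw [hi, hj, max_eq_right (by omega)] at e1
    rw [hi, hj, max_eq_left (by omega)] at e2
    have e3 : A i j = r := by omega
    have e4 : A j i = 1 := by
      have : r * A j i = r * 1 := by omega
      exact mul_left_cancel₀ hrp.ne' this
    have h3 := hr3 i j hi hj e3 e4 hij
    have hpi := hp i 1 (by rw [hi]; rfl)
    rw [pow_one] at hpi
    have hr23 : r = 2 ∨ r = 3 := by omega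
    rcases hr23 with rfl | rfl
    · have hpj := hp j 2 (by rw [hj]; rfl)
      refine ⟨4, ⟨?_, ?_, ?_⟩, ⟨?_, ?_, ?_⟩⟩
      · rw [e3, e4]
        have := rk_two (Subsemiring.nonneg ℤ) 1 1 (by norm_num) (by simp)
        norm_num at this; exact this
      · rw [e3, e4]; decide
      · rw [hpi, hpj, hB2 i j hij e3, hB1 j i hij.symm e4]
        exact rk_two P q q' hq h1
      · rw [e3, e4]
        have := rk_two' (Subsemiring.nonneg ℤ) 1 1 (by norm_num) (by simp)
        norm_num at this; exact this
      · rw [e3, e4]; decide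
      · rw [hpi, hpj, hB2 i j hij e3, hB1 j i hij.symm e4]
        exact rk_two' P q q' hq h1
    · have hpj := hp j 3 (by rw [hj]; rfl)
      refine ⟨6, ⟨?_, ?_, ?_⟩, ⟨?_, ?_, ?_⟩⟩
      · rw [e3, e4]
        have := rk_three (Subsemiring.nonneg ℤ) 1 1 (by norm_num) (by simp) (by simp)
        norm_num at this; exact this
      · rw [e3, e4]; decide
      · rw [hpi, hpj, hB3 i j hij e3, hB1 j i hij.symm e4]
        exact rk_three P q q' hq h1 h2
      · rw [e3, e4]
        have := rk_three' (Subsemiring.nonneg ℤ) 1 1 (by norm_num) (by simp)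
        norm_num at this; exact this
      · rw [e3, e4]; decide
      · rw [hpi, hpj, hB3 i j hij e3, hB1 j i hij.symm e4]
        exact rk_three' P q q' hq h1
  by_cases hAij : A i j = 0
  · have hAji := hz i j hAij
    refine ⟨2, ⟨?_, ?_, ?_⟩, ⟨?_, ?_, ?_⟩⟩
    · rw [hAij, hAji]; exact rk_zero _ _ _
    · rw [hAij, hAji]; decide
    · rw [hB0 i j hij hAij, hB0 j i hij.symm hAji]; exact rk_zero _ _ _
    · rw [hAij, hAji]; exact rk_zero _ _ _
    · rw [hAij, hAji]; decide
    · rw [hB0 i j hij hAij, hB0 j i hij.symm hAji]; exact rk_zero _ _ _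
  have hAji : A j i ≠ 0 := fun h => hAij (hz _ _ h)
  by_cases hdd : d i = d j
  · have e : ∀ i j, d i = d j → A i j ≠ 0 → A i j = 1 := by
      intro i j h h'
      have := hmax i j h'
      rw [h, max_self] at this
      exact mul_left_cancel₀ (hdpos j).ne' (by rw [this, mul_one])
    have e1 := e i j hdd hAij
    have e2 := e j i hdd.symm hAji
    obtain ⟨n, hn⟩ := Int.eq_ofNat_of_zero_le (hdpos i).le
    have p1 := hp i n hn
    have p2 := hp j n (by rw [← hdd]; exact hn)
    have hqn : q ^ n ∈ P := pow_mem h1 n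
    refine ⟨3, ⟨?_, ?_, ?_⟩, ⟨?_, ?_, ?_⟩⟩
    · rw [e1, e2]; exact rk_one _ _ (by simp)
    · rw [e1, e2]; decide
    · rw [p1, p2, hB1 i j hij e1, hB1 j i hij.symm e2]; exact rk_one _ _ hqn
    · rw [e1, e2]; exact rk_one _ _ (by simp)
    · rw [e1, e2]; decide
    · rw [p1, p2, hB1 i j hij e1, hB1 j i hij.symm e2]; exact rk_one _ _ hqn
  rcases hone i with hi | hi <;> rcases hone j with hj | hj
  · exact absurd (hi.trans hj.symm) hdd
  · exact hspec i j hij hi hj (by omega) hAij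
  · obtain ⟨m, h, h'⟩ := hspec j i hij.symm hj hi (by omega) hAji
    exact ⟨m, h', h⟩
  · exact absurd (hi.trans hj.symm) hdd

theorem pos_all [Fintype I] [DecidableEq I] [Nonempty I]
    (A : I → I → ℤ) (d : I → ℤ) (r : ℤ) (hA : ∀ i, A i i = 0) (hAnn : ∀ i j, 0 ≤ A i j)
    (hd : ∀ i j, d i * A i j = d j * A j i) (hdpos : ∀ i, 0 < d i)
    (hone : ∀ i, d i = 1 ∨ d i = r) (hr : 0 < r)
    (hmax : ∀ i j, A i j ≠ 0 → d i * A i j = max (d i) (d j))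
    (hconn : ∀ i j : I, Relation.ReflTransGen (fun a b => A a b ≠ 0) i j)
    (θ : I → ℤ) (L0 : List I) (j0 : I) (hθ : θ = sact A L0 (Pi.single j0 1))
    (hhigh : ∀ L j, sact A L (Pi.single j 1) ≤ θ)
    {R : Type} [CommRing R] (P : Subsemiring R) (q q' : R) (hq : q * q' = 1) (h1 : q ∈ P)
    (h2 : q' ∈ P) (p : I → R) (B : I → I → R) (hp : ∀ i (n : ℕ), d i = n → p i = q ^ n)
    (hB : ∀ i, B i i = 0)
    (hB0 : ∀ i j, i ≠ j → A i j = 0 → B i j = 0) (hB1 : ∀ i j, i ≠ j → A i j = 1 → B i j = 1)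
    (hB2 : ∀ i j, i ≠ j → A i j = 2 → B i j = q + q')
    (hB3 : ∀ i j, i ≠ j → A i j = 3 → B i j = q ^ 2 + 1 + q' ^ 2)
    (j : I) (n : ℕ) (hn : (n : ℤ) ≤ 1 + ∑ i, θ i) (k : I) : xs p B j n k ∈ P := by
  have hθ1 : ∀ i, 1 ≤ θ i := by
    intro i
    have := hhigh [] i i
    simpa [sact] using this
  have hdom : ∀ i, 0 ≤ cv A θ i := by
    intro i
    have := hhigh (i :: L0) j0 i
    rw [sact, act_cons, Module.End.mul_apply] at this
    change Tg _ A i (sact A L0 _) i ≤ _ at this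
    rw [← hθ, s_eq] at this
    simp at this
    exact this
  have hnorm : 0 < frm A d θ θ := by
    rw [hθ, frm_root A d hA hd]
    have := hdpos j0
    omega
  have hpd := posdef_A A hAnn d hd hdpos hconn θ hθ1 hdom hnorm
  have hr3 : ∀ i j, d i = 1 → d j = r → A i j = r → A j i = 1 → i ≠ j → r ≤ 3 :=
    fun i j a1 a2 a3 a4 a5 => edge_bound A hA d r hr hpd i j a5 a1 a2 a3 a4
  obtain ⟨ε, hε⟩ := bipart A hA hAnn d hd hdpos hmax hconn hpd
  have hrk := hrk_of A d r hd hdpos hone hmax hr3 P q q' hq h1 h2 p B hp hB0 hB1 hB2 hB3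
  have hsign := root_sign A hA p B hB P hrk
  have hy := main_pos A hA hAnn d hd hdpos hconn ε hε hsign θ L0 j0 hθ hhigh
  have hεB : ∀ i k, ε i = ε k → B i k = 0 := by
    intro i k h
    by_cases hik : i = k
    · subst hik; exact hB i
    · exact hB0 i k hik (hε i k h)
  cases n with
  | zero => exact P.zero_mem
  | succ n =>
    have hn' : (n : ℤ) < 1 + ∑ i, θ i := by push_cast at hn; omega
    have hg : Gd A 1 (Bw ε n (not^[n] (ε j))) :=
      Gd_Bw A ε hε n (fun k hk j => hy k (by have : (k : ℤ) < n := by exact_mod_cast hk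
                                             omega) j) _
    have hs : sact A (Bw ε n (not^[n] (ε j))) (Pi.single j 1) = _ := act_Bw (fun _ => 1) A ε hε j n
    rcases key_thm A hA p B hB P hrk _ _ rfl hg j with h | h
    · have h3 := h.2 k
      rw [act_Bw p B ε hεB] at h3
      rcases xs_split p B ε hεB j n k with h4 | h4
      · rw [h4]; exact P.zero_mem
      · rwa [Pi.add_apply, h4, add_zero] at h3
    · exfalso
      refine sact_single_ne A hA (Bw ε n (not^[n] (ε j))) j (le_antisymm h.1 ?_)
      rw [hs]
      exact hy n hn' j

/-- Laurent series with nonnegative coefficients. -/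
def PosFF : Subsemiring FF where
  carrier := {x | ∀ n, 0 ≤ x.coeff n}
  zero_mem' := by intro n; simp
  one_mem' := by
    intro n
    rw [HahnSeries.coeff_one]
    split_ifs <;> simp
  add_mem' := by
    intro a b ha hb n
    rw [HahnSeries.coeff_add]
    exact add_nonneg (ha n) (hb n)
  mul_mem' := by
    intro a b ha hb n
    rw [HahnSeries.coeff_mul]
    exact Finset.sum_nonneg fun x _ => mul_nonneg (ha _) (hb _)

/-- the variable `q` in `ℚ((q))`. -/
def q0 : FF := HahnSeries.single (1 : ℤ) (1 : ℚ)

theorem q0_ne : q0 ≠ 0 := by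
  simp [q0]

theorem q0_inv : q0⁻¹ = HahnSeries.single (-1 : ℤ) (1 : ℚ) := by
  apply inv_eq_of_mul_eq_one_right
  simp [q0]

theorem single_mem (n : ℤ) : (HahnSeries.single n (1 : ℚ) : FF) ∈ PosFF := by
  intro m
  rw [HahnSeries.coeff_single]
  split_ifs <;> simp

theorem q0_sub_ne : q0 - q0⁻¹ ≠ 0 := by
  intro h
  have := congrArg (fun x : FF => x.coeff 1) h
  rw [q0_inv] at this
  simp [q0] at this

/-- Quantum integers in `ℚ((q))`. -/
def qi0 (k : ℤ) : FF := (q0 ^ k - q0 ^ (-k)) / (q0 - q0⁻¹)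

theorem qi0_zero : qi0 0 = 0 := by simp [qi0]

theorem qi0_one : qi0 (-1) = -1 := by
  unfold qi0
  rw [div_eq_iff q0_sub_ne]
  simp

theorem qi0_two : qi0 (-2) = -(q0 + q0⁻¹) := by
  unfold qi0
  rw [div_eq_iff q0_sub_ne]
  have : q0 ^ (-2 : ℤ) = q0⁻¹ ^ 2 := by rw [zpow_neg, inv_pow]; norm_cast
  rw [this, neg_neg]
  have : q0 ^ (2 : ℤ) = q0 ^ 2 := by norm_cast
  rw [this]
  ring

theorem qi0_three : qi0 (-3) = -(q0 ^ 2 + 1 + q0⁻¹ ^ 2) := by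
  unfold qi0
  rw [div_eq_iff q0_sub_ne]
  have : q0 ^ (-3 : ℤ) = q0⁻¹ ^ 3 := by rw [zpow_neg, inv_pow]; norm_cast
  rw [this, neg_neg]
  have : q0 ^ (3 : ℤ) = q0 ^ 3 := by norm_cast
  rw [this]
  have e : q0 * q0⁻¹ = 1 := mul_inv_cancel₀ q0_ne
  linear_combination (-q0 + q0⁻¹) * e

theorem phi_zpow (φ : KK →+* LL) (hφq : φ qv = qL) (k : ℤ) :
    φ (qv ^ k) = HahnSeries.C (q0 ^ k) := by
  rw [map_zpow₀, map_zpow₀, hφq]; rfl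

theorem phi_qint (φ : KK →+* LL) (hφq : φ qv = qL) (k : ℤ) :
    φ (qint k) = HahnSeries.C (qi0 k) := by
  unfold qint qi0
  rw [map_div₀, map_div₀, map_sub, map_sub, map_sub, map_sub, phi_zpow φ hφq, phi_zpow φ hφq,
    map_inv₀, map_inv₀, hφq]
  rfl

theorem tL_inv : tL⁻¹ = HahnSeries.single (1 : ℤ) (1 : FF) := by
  apply inv_eq_of_mul_eq_one_right
  simp [tL]

theorem coeff_t (x : LL) (n : ℤ) : (tL * x).coeff n = x.coeff (n + 1) := by
  have := HahnSeries.coeff_single_mul_add (r := (1 : FF)) (x := x) (a := n + 1) (b := -1)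
  simpa [tL] using this

theorem coeff_t_inv (x : LL) (n : ℤ) : (tL⁻¹ * x).coeff n = x.coeff (n - 1) := by
  have := HahnSeries.coeff_single_mul_add (r := (1 : FF)) (x := x) (a := n - 1) (b := 1)
  rw [tL_inv]
  simpa using this

theorem coeff_Cmul (a : FF) (x : LL) (n : ℤ) : (HahnSeries.C a * x).coeff n = a * x.coeff n := by
  rw [HahnSeries.C_mul_eq_smul]; rfl

/-- coefficients of the inverse satisfy the basic recursion -/
theorem link [Fintype I] [DecidableEq I] (d : I → ℤ) (B : I → I → FF) (j : I)
    (F : I → LL)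
    (hF : ∀ n i, q0 ^ (d i) * (F i).coeff (n - 1) + q0 ^ (-(d i)) * (F i).coeff (n + 1)
      - ∑ k, B i k * (F k).coeff n = if n = 0 ∧ i = j then 1 else 0) (n : ℕ) (i : I) :
    (F i).coeff n = q0 ^ (d j) * xs (fun i => q0 ^ (d i)) B j n i := by
  have hrec : ∀ n i, (F i).coeff (n + 1) = -(q0 ^ (d i)) ^ 2 * (F i).coeff (n - 1) +
      q0 ^ (d i) * ∑ k, B i k * (F k).coeff n + if n = 0 ∧ i = j then q0 ^ (d i) else 0 := by
    intro n i
    have h := hF n i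
    have e : q0 ^ (d i) * q0 ^ (-(d i)) = 1 := by
      rw [← zpow_add₀ q0_ne]; simp
    have e2 : (if n = 0 ∧ i = j then q0 ^ (d i) else 0) =
      q0 ^ (d i) * (if n = 0 ∧ i = j then 1 else 0) := by split_ifs <;> simp
    rw [e2, ← h]
    linear_combination (-(F i).coeff (n + 1)) * e
  obtain ⟨n0, hn0⟩ : ∃ n0 : ℤ, ∀ i, n0 ≤ (F i).order := by
    obtain ⟨b, hb⟩ := (Set.finite_range (fun i => (F i).order)).bddBelow
    exact ⟨b, fun i => hb ⟨i, rfl⟩⟩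
  have hlow : ∀ n < n0, ∀ i, (F i).coeff n = 0 := by
    intro n hn i
    exact HahnSeries.coeff_eq_zero_of_lt_order (lt_of_lt_of_le hn (hn0 i))
  have hneg : ∀ m : ℕ, ∀ n : ℤ, n ≤ 0 → n < n0 + m → ∀ i, (F i).coeff n = 0 := by
    intro m
    induction m with
    | zero => intro n _ h; exact hlow n (by simpa using h)
    | succ m ih =>
      intro n hn h i
      have := hrec (n - 1) i
      rw [sub_add_cancel, ih (n - 1 - 1) (by omega) (by push_cast at h; omega) i,
        Finset.sum_eq_zero (fun k _ => by
          rw [ih (n - 1) (by omega) (by push_cast at h; omega) k, mul_zero]),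
        if_neg (by omega)] at this
      rw [this]; simp
  have hneg' : ∀ n : ℤ, n ≤ 0 → ∀ i, (F i).coeff n = 0 := by
    intro n hn
    exact hneg (n - n0 + 1).toNat n hn (by omega)
  induction n using Nat.strong_induction_on generalizing i with
  | _ n ih =>
  match n with
  | 0 => simp [xs, hneg' 0 le_rfl]
  | 1 =>
    have := hrec 0 i
    rw [hneg' (0 - 1) (by omega), Finset.sum_eq_zero (fun k _ => by
      rw [hneg' 0 le_rfl, mul_zero])] at this
    rw [zero_add] at this
    simp only [Nat.cast_one]
    rw [this]
    by_cases h : i = j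
    · subst h; simp [xs]
    · simp [xs, h]
  | n + 2 =>
    have := hrec ((n : ℤ) + 1) i
    rw [if_neg (by omega)] at this
    rw [show ((n + 2 : ℕ) : ℤ) = (n : ℤ) + 1 + 1 by push_cast; ring, this]
    rw [add_sub_cancel_right, ih n (by omega)]
    have e : ∑ k, B i k * (F k).coeff ((n : ℤ) + 1) =
      q0 ^ (d j) * ∑ k, B i k * xs (fun i => q0 ^ (d i)) B j (n + 1) k := by
      rw [Finset.mul_sum]
      apply Finset.sum_congr rfl
      intro k _
      have := ih (n + 1) (by omega) k
      push_cast at this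
      rw [this]; ring
    rw [e]
    simp only [xs]
    ring

theorem sZ_eq [Fintype I] [DecidableEq I] (c : I → I → ℤ) (hdiag : ∀ i, c i i = 2) (i : I)
    (v : I → ℤ) :
    sZ c i v = Tg (fun _ => 1) (fun i j => if i = j then 0 else - c i j) i v := by
  ext k
  rw [s_eq]
  have : cv (fun i j => if i = j then 0 else - c i j) v i = ∑ j, c i j * v j := by
    unfold cv
    rw [sub_eq_iff_eq_add, ← Finset.sum_add_distrib]
    rw [Finset.sum_eq_single i]
    · simp [hdiag]
    · intro b _ hb
      simp [Ne.symm hb]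
    · simp
  rw [this]
  by_cases hk : k = i
  · subst hk; simp [sZ]; ring
  · simp [sZ, hk]

theorem word_eq [Fintype I] [DecidableEq I] (c : I → I → ℤ) (hdiag : ∀ i, c i i = 2) (L : List I)
    (v : I → ℤ) :
    (L.map (sZ c)).foldr (· ∘ ·) id v = sact (fun i j => if i = j then 0 else - c i j) L v := by
  induction L with
  | nil => simp [sact]
  | cons a L ih =>
    rw [List.map_cons, List.foldr_cons, Function.comp_apply, ih, sZ_eq c hdiag, sact, sact, act_cons,
      Module.End.mul_apply]

theorem statement_12
    {I : Type} [Fintype I] [DecidableEq I] [Nonempty I]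
    (c : I → I → ℤ) (d : I → ℤ) (r : ℤ)
    -- `C` is a symmetrizable generalized Cartan matrix
    (hdiag : ∀ i, c i i = 2)
    (hoff : ∀ i j, i ≠ j → c i j ≤ 0)
    -- `(d_i)` are positive integers with gcd 1 symmetrizing `C`
    (hdpos : ∀ i, 0 < d i)
    (hgcd : Finset.univ.gcd d = 1)
    (hsymm : ∀ i j, d i * c i j = d j * c j i)
    -- each `d_i ∈ {1, r}` where `r = max_i d_i`
    (honer : ∀ i, d i = 1 ∨ d i = r)
    (hrmax : ∀ i, d i ≤ r)
    (hrmem : ∃ i, d i = r)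
    -- `d_i c_{ij} = -max(d_i, d_j)` whenever `i ≠ j` and `c_{ij} ≠ 0`
    (hbmax : ∀ i j, i ≠ j → c i j ≠ 0 → d i * c i j = -(max (d i) (d j)))
    -- `C` is indecomposable
    (hconn : ∀ i j : I, Relation.ReflTransGen (fun a b => a ≠ b ∧ c a b ≠ 0) i j)
    -- `C` is of finite type: the Weyl group is finite
    (hWfin : {w : (I → ℤ) → (I → ℤ) | memW c w}.Finite)
    -- `θ = Σ a_i α_i` is the highest root: `θ ∈ Φ` and `θ - β ∈ Q₊` for all `β ∈ Φ`;
    -- then `h = 1 + Σ a_i` and `N = r + Σ a_i d_i = r h^∨`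
    (θ : I → ℤ)
    (hθΦ : ∃ w, memW c w ∧ ∃ i, θ = w (alphaZ i))
    (hθhigh : ∀ β : I → ℤ, (∃ w, memW c w ∧ ∃ i, β = w (alphaZ i)) → ∀ k, β k ≤ θ k)
    -- `φ` is the double Laurent expansion of `ℚ(q,t)`: first in `t⁻¹` (at `t = ∞`),
    -- then at `q = 0`; it is the unique ring homomorphism `ℚ(q,t) → ℚ((q))((t⁻¹))`
    -- sending `q`, `t` to their canonical images
    (φ : KK →+* LL)
    (hφq : φ qv = qL)
    (hφt : φ tv = tL)
    :
    ∀ (i j : I) (u v : ℤ), 0 ≤ u → u ≤ r + ∑ k, θ k * d k →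
      -(1 + ∑ k, θ k) ≤ v → v ≤ 0 →
      0 ≤ dcoeff (φ ((Matrix.of (Cqt c d))⁻¹ i j)) u v
    := by

  classical
  intro i j u v _ _ hv hv0
  set A : I → I → ℤ := fun i j => if i = j then 0 else - c i j with hAdef
  set B : I → I → FF := fun i j => if i = j then 0 else - qi0 (c i j) with hBdef
  have hAne : ∀ a b, A a b ≠ 0 ↔ a ≠ b ∧ c a b ≠ 0 := by
    intro a b
    by_cases h : a = b <;> simp [hAdef, h]
  obtain ⟨w, ⟨L0, hw⟩, j0, hθ⟩ := hθΦ
  have hpos := pos_all A d r (by simp [hAdef])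
    (by
      intro a b
      by_cases h : a = b
      · simp [hAdef, h]
      · have := hoff a b h
        simp [hAdef, h, this])
    (by
      intro a b
      by_cases h : a = b
      · simp [hAdef, h]
      · have := hsymm a b
        simp [hAdef, h, Ne.symm h, this])
    hdpos honer (by obtain ⟨k, hk⟩ := hrmem; rw [← hk]; exact hdpos k)
    (by
      intro a b h
      rw [hAne] at h
      have := hbmax a b h.1 h.2
      simp [hAdef, h.1, this])
    (by
      intro a b
      refine Relation.ReflTransGen.mono ?_ a b (hconn a b)
      intro x y hxy
      exact (hAne x y).2 hxy)
    θ L0 j0 (by rw [hθ, hw, word_eq c hdiag]; rfl)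
    (by
      intro L k l
      refine hθhigh _ ⟨_, ⟨L, rfl⟩, k, ?_⟩ l
      rw [word_eq c hdiag]; rfl)
    PosFF q0 q0⁻¹ (mul_inv_cancel₀ q0_ne) (single_mem 1) (by rw [q0_inv]; exact single_mem (-1))
    (fun i => q0 ^ (d i)) B
    (by intro a n h; simp only [h]; norm_cast)
    (by simp [hBdef])
    (by
      intro a b hab h
      have : c a b = 0 := by simpa [hAdef, hab] using h
      simp [hBdef, hab, this, qi0_zero])
    (by
      intro a b hab h
      have : c a b = -1 := by simp [hAdef, hab] at h; omega
      simp [hBdef, hab, this, qi0_one])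
    (by
      intro a b hab h
      have : c a b = -2 := by simp [hAdef, hab] at h; omega
      simp only [hBdef, hab, this, qi0_two, if_false, neg_neg])
    (by
      intro a b hab h
      have : c a b = -3 := by simp [hAdef, hab] at h; omega
      simp only [hBdef, hab, this, qi0_three, if_false, neg_neg])
    j (-v).toNat (by omega) i
  by_cases hdet : IsUnit (Matrix.of (Cqt c d)).det
  swap
  · rw [Matrix.nonsing_inv_apply_not_isUnit _ hdet]
    simp [dcoeff]
  have hmul := Matrix.mul_nonsing_inv _ hdet
  set N := (Matrix.of (Cqt c d))⁻¹ with hN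
  have hlink := link d B j (fun i => φ (N i j)) (by
    intro n a
    have h := congrFun (congrFun hmul a) j
    rw [Matrix.mul_apply] at h
    have h1 := congrArg (fun x => (φ x).coeff n) h
    simp only [map_sum, map_mul, Matrix.of_apply, HahnSeries.coeff_sum] at h1
    have hterm : ∀ k, (φ (Cqt c d a k) * φ (N k j)).coeff n =
        (if a = k then q0 ^ (d a) * (φ (N a j)).coeff (n - 1)
          + q0 ^ (-(d a)) * (φ (N a j)).coeff (n + 1) else 0) - B a k * (φ (N k j)).coeff n := by
      intro k
      by_cases hk : a = k
      · subst hk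
        simp only [Cqt, hBdef, if_true, map_add, map_mul, phi_zpow φ hφq, map_inv₀, hφt]
        rw [add_mul, HahnSeries.coeff_add, mul_assoc, mul_assoc, coeff_Cmul, coeff_Cmul, coeff_t,
          coeff_t_inv, zero_mul, sub_zero]
      · simp only [Cqt, hBdef, hk, if_false, phi_qint φ hφq]
        rw [coeff_Cmul]; ring
    rw [Finset.sum_congr rfl (fun k _ => hterm k), Finset.sum_sub_distrib,
      Finset.sum_ite_eq, if_pos (Finset.mem_univ _)] at h1
    rw [h1, Matrix.one_apply]
    by_cases ha : a = j
    · simp [ha, HahnSeries.coeff_one]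
    · simp [ha]) (-v).toNat i
  have hvn : (((-v).toNat : ℕ) : ℤ) = -v := by omega
  rw [hvn] at hlink
  unfold dcoeff
  rw [hlink]
  have hq : q0 ^ (d j) ∈ PosFF := by
    obtain ⟨n, hn⟩ := Int.eq_ofNat_of_zero_le (hdpos j).le
    rw [hn, zpow_natCast]
    exact pow_mem (single_mem 1) n
  exact PosFF.mul_mem hq hpos u
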